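/- There exists a unique skew-dual pairing ⟨,⟩ : B'(so_{2n+1}) × B(so_{2n+1}) → ℚ(r,s) of the Hopf algebras B(so_{2n+1}) and B'(so_{2n+1}) such that: ⟨f_i, e_j⟩ = δ_{ij}/(s_i − r_i); ⟨ω_i', ω_j⟩ = r^{2(ε_j,α_i)}s^{2(ε_{j+1},α_i)} for i ≤ n and j < n; ⟨ω_i', ω_n⟩ = r^{2(ε_n,α_i)} for i < n; ⟨ω_n', ω_n⟩ = r^{(ε_n,α_n)}s^{-(ε_n,α_n)} = rs^{-1}; ⟨ω_i'^{±1}, ω_j^{-1}⟩ = ⟨ω_i'^{±1}, ω_j⟩^{-1} = ⟨ω_i', ω_j⟩^{∓1}; and all other pairs of generators pair to 0. Moreover this pairing satisfies ⟨S(a), S(b)⟩ = ⟨a, b⟩ for all a ∈ B'(so_{2n+1}), b ∈ B(so_{2n+1}). -/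

import Mathlib

/-!
STATEMENT 4.  There exists a unique skew-dual pairing
⟨,⟩ : B'(so_{2n+1}) × B(so_{2n+1}) → ℚ(r,s) of the Hopf algebras B(so_{2n+1})
(generated by the e_j, ω_j^{±1}) and B'(so_{2n+1}) (generated by the f_j, ω_j'^{±1}),
with the prescribed values on generators, all other pairs of generators pairing to 0;
moreover the pairing satisfies ⟨S(a), S(b)⟩ = ⟨a, b⟩.  (Type Bₙ; the rank is n+1 for
a parameter n : ℕ and all indices are 0-based, the last simple root being α_n = ε_n.)
-/

noncomputable section
open scoped TensorProduct

/-- K = ℚ(r,s) -/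
abbrev KK : Type := FractionRing (MvPolynomial (Fin 2) ℚ)
def qr : KK := algebraMap (MvPolynomial (Fin 2) ℚ) KK (MvPolynomial.X 0)
def qs : KK := algebraMap (MvPolynomial (Fin 2) ℚ) KK (MvPolynomial.X 1)

/-- generators e_i, ω_i^{±1} of the positive Hopf subalgebra B -/
inductive GenE (N : ℕ) | e (i : Fin N) | w (i : Fin N) | winv (i : Fin N)

/-- generators f_i, ω_i'^{±1} of the negative Hopf subalgebra B' -/
inductive GenF (N : ℕ) | f (i : Fin N) | wp (i : Fin N) | wpinv (i : Fin N)

def GenE.toral {N : ℕ} : GenE N → Prop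
  | .e _ => False
  | _ => True

def GenF.toral {N : ℕ} : GenF N → Prop
  | .f _ => False
  | _ => True

/-- (ε_j, α_i) for type Bₙ of rank n+1 (0-indexed). -/
def ipaB (n : ℕ) (j i : ℕ) : ℤ :=
  if i < n then (if j = i then 1 else 0) - (if j = i+1 then 1 else 0)
  else (if j = n then 1 else 0)

/-- r_i = r^{(α_i,α_i)} -/
def riB (n : ℕ) (ρ : KK) (i : ℕ) : KK := if i < n then ρ^2 else ρ

/-- the pairing values ⟨ω_i', ω_j⟩ of Proposition 2.3 (4B) -/
def cstB (n : ℕ) (i j : Fin (n+1)) : KK :=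
  if (j:ℕ) < n then qr^(2 * ipaB n j i) * qs^(2 * ipaB n ((j:ℕ)+1) i)
  else if (i:ℕ) < n then qr^(2 * ipaB n n i)
  else qr * qs⁻¹

abbrev FE (n : ℕ) : Type := FreeAlgebra KK (GenE (n+1))
abbrev FF (n : ℕ) : Type := FreeAlgebra KK (GenF (n+1))
abbrev XE {n : ℕ} : GenE (n+1) → FE n := FreeAlgebra.ι KK
abbrev XF {n : ℕ} : GenF (n+1) → FF n := FreeAlgebra.ι KK

/-- the defining relations of B(so_{2(n+1)+1}) -/
inductive RelBE (n : ℕ) : FE n → FE n → Prop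
  | comm (g g' : GenE (n+1)) (hg : g.toral) (hg' : g'.toral) :
      RelBE n (XE g * XE g') (XE g' * XE g)
  | winv_r (i : Fin (n+1)) : RelBE n (XE (.w i) * XE (.winv i)) 1
  | winv_l (i : Fin (n+1)) : RelBE n (XE (.winv i) * XE (.w i)) 1
  | b2we (i j : Fin (n+1)) (hj : (j:ℕ) < n) :
      RelBE n (XE (.w j) * XE (.e i) * XE (.winv j))
        (((riB n qr j)^(ipaB n j i) * (riB n qs j)^(ipaB n ((j:ℕ)+1) i)) • XE (.e i))
  | b2wne (j : Fin (n+1)) (hj : (j:ℕ) < n) :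
      RelBE n (XE (.w (Fin.last n)) * XE (.e j) * XE (.winv (Fin.last n)))
        ((riB n qr n)^(2 * ipaB n n j) • XE (.e j))
  | b2wnen :
      RelBE n (XE (.w (Fin.last n)) * XE (.e (Fin.last n)) * XE (.winv (Fin.last n)))
        ((riB n qr n * (riB n qs n)⁻¹) • XE (.e (Fin.last n)))
  | b5e (i j : Fin (n+1)) (h : (i:ℕ)+1 < j ∨ (j:ℕ)+1 < i) :
      RelBE n (XE (.e i) * XE (.e j) - XE (.e j) * XE (.e i)) 0
  | b6a (i j : Fin (n+1)) (hij : (j:ℕ) = (i:ℕ)+1) (h : (i:ℕ) < n) :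
      RelBE n (XE (.e i)^2 * XE (.e j)
        - (riB n qr i + riB n qs i) • (XE (.e i) * XE (.e j) * XE (.e i))
        + (riB n qr i * riB n qs i) • (XE (.e j) * XE (.e i)^2)) 0
  | b6b (i j : Fin (n+1)) (hij : (j:ℕ) = (i:ℕ)+1) (h : (i:ℕ)+1 < n) :
      RelBE n (XE (.e j)^2 * XE (.e i)
        - ((riB n qr ((i:ℕ)+1))⁻¹ + (riB n qs ((i:ℕ)+1))⁻¹) • (XE (.e j) * XE (.e i) * XE (.e j))
        + (riB n qr ((i:ℕ)+1) * riB n qs ((i:ℕ)+1))⁻¹ • (XE (.e i) * XE (.e j)^2)) 0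
  | b6c (i : Fin (n+1)) (h : (i:ℕ)+1 = n) :
      RelBE n (XE (.e (Fin.last n))^3 * XE (.e i)
        - (qr^(-2:ℤ) + qr⁻¹*qs⁻¹ + qs^(-2:ℤ)) • (XE (.e (Fin.last n))^2 * XE (.e i) * XE (.e (Fin.last n)))
        + ((qr*qs)⁻¹ * (qr^(-2:ℤ) + qr⁻¹*qs⁻¹ + qs^(-2:ℤ))) • (XE (.e (Fin.last n)) * XE (.e i) * XE (.e (Fin.last n))^2)
        - (qr*qs)^(-3:ℤ) • (XE (.e i) * XE (.e (Fin.last n))^3)) 0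

/-- the defining relations of B'(so_{2(n+1)+1}) -/
inductive RelBF (n : ℕ) : FF n → FF n → Prop
  | comm (g g' : GenF (n+1)) (hg : g.toral) (hg' : g'.toral) :
      RelBF n (XF g * XF g') (XF g' * XF g)
  | wpinv_r (i : Fin (n+1)) : RelBF n (XF (.wp i) * XF (.wpinv i)) 1
  | wpinv_l (i : Fin (n+1)) : RelBF n (XF (.wpinv i) * XF (.wp i)) 1
  | b3wpf (i j : Fin (n+1)) (hj : (j:ℕ) < n) :
      RelBF n (XF (.wp j) * XF (.f i) * XF (.wpinv j))
        (((riB n qs j)^(-(ipaB n j i)) * (riB n qr j)^(-(ipaB n ((j:ℕ)+1) i))) • XF (.f i))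
  | b3wpnf (j : Fin (n+1)) (hj : (j:ℕ) < n) :
      RelBF n (XF (.wp (Fin.last n)) * XF (.f j) * XF (.wpinv (Fin.last n)))
        ((riB n qs n)^(-(2 * ipaB n n j)) • XF (.f j))
  | b3wpnfn :
      RelBF n (XF (.wp (Fin.last n)) * XF (.f (Fin.last n)) * XF (.wpinv (Fin.last n)))
        (((riB n qs n)⁻¹ * riB n qr n) • XF (.f (Fin.last n)))
  | b5f (i j : Fin (n+1)) (h : (i:ℕ)+1 < j ∨ (j:ℕ)+1 < i) :
      RelBF n (XF (.f i) * XF (.f j) - XF (.f j) * XF (.f i)) 0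
  | b7a (i j : Fin (n+1)) (hij : (j:ℕ) = (i:ℕ)+1) (h : (i:ℕ) < n) :
      RelBF n (XF (.f j) * XF (.f i)^2
        - (riB n qr i + riB n qs i) • (XF (.f i) * XF (.f j) * XF (.f i))
        + (riB n qr i * riB n qs i) • (XF (.f i)^2 * XF (.f j))) 0
  | b7b (i j : Fin (n+1)) (hij : (j:ℕ) = (i:ℕ)+1) (h : (i:ℕ)+1 < n) :
      RelBF n (XF (.f i) * XF (.f j)^2
        - ((riB n qr ((i:ℕ)+1))⁻¹ + (riB n qs ((i:ℕ)+1))⁻¹) • (XF (.f j) * XF (.f i) * XF (.f j))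
        + (riB n qr ((i:ℕ)+1) * riB n qs ((i:ℕ)+1))⁻¹ • (XF (.f j)^2 * XF (.f i))) 0
  | b7c (i : Fin (n+1)) (h : (i:ℕ)+1 = n) :
      RelBF n (XF (.f i) * XF (.f (Fin.last n))^3
        - (qr^(-2:ℤ) + qr⁻¹*qs⁻¹ + qs^(-2:ℤ)) • (XF (.f (Fin.last n)) * XF (.f i) * XF (.f (Fin.last n))^2)
        + ((qr*qs)⁻¹ * (qr^(-2:ℤ) + qr⁻¹*qs⁻¹ + qs^(-2:ℤ))) • (XF (.f (Fin.last n))^2 * XF (.f i) * XF (.f (Fin.last n)))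
        - (qr*qs)^(-3:ℤ) • (XF (.f (Fin.last n))^3 * XF (.f i))) 0

/-- the Hopf subalgebra B (upper part) -/
abbrev BA (n : ℕ) : Type := RingQuot (RelBE n)
/-- the Hopf subalgebra B' (lower part) -/
abbrev BA' (n : ℕ) : Type := RingQuot (RelBF n)

def genBE (n : ℕ) (g : GenE (n+1)) : BA n := RingQuot.mkAlgHom KK (RelBE n) (XE g)
def genBF (n : ℕ) (g : GenF (n+1)) : BA' n := RingQuot.mkAlgHom KK (RelBF n) (XF g)

/-- the conditions defining the skew-dual pairing ⟨,⟩ : B' × B → K of Proposition 2.3: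
it is a dual pairing of B'^{cop} and B, with the prescribed values on generators
(all other pairs of generators pairing to 0). -/
def PairCond (n : ℕ) (ΔB : BA n →ₐ[KK] (BA n ⊗[KK] BA n)) (εB : BA n →ₐ[KK] KK)
    (ΔB' : BA' n →ₐ[KK] (BA' n ⊗[KK] BA' n)) (εB' : BA' n →ₐ[KK] KK)
    (p : BA' n →ₗ[KK] BA n →ₗ[KK] KK) : Prop :=
  (∀ f, p f 1 = εB' f) ∧ (∀ a, p 1 a = εB a) ∧
  -- ⟨f, a a'⟩ = Σ ⟨f_(2), a⟩⟨f_(1), a'⟩  (skew/cop on the B' side)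
  (∀ f a a', p f (a * a')
    = LinearMap.mul' KK KK ((TensorProduct.map (p.flip a') (p.flip a)) (ΔB'.toLinearMap f))) ∧
  -- ⟨f f', a⟩ = Σ ⟨f, a_(1)⟩⟨f', a_(2)⟩
  (∀ f f' a, p (f * f') a
    = LinearMap.mul' KK KK ((TensorProduct.map (p f) (p f')) (ΔB.toLinearMap a))) ∧
  (∀ i j, p (genBF n (.f i)) (genBE n (.e j))
    = if i = j then (riB n qs i - riB n qr i)⁻¹ else 0) ∧
  (∀ i j, p (genBF n (.wp i)) (genBE n (.w j)) = cstB n i j) ∧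
  (∀ i j, p (genBF n (.wp i)) (genBE n (.winv j)) = (cstB n i j)⁻¹) ∧
  (∀ i j, p (genBF n (.wpinv i)) (genBE n (.w j)) = (cstB n i j)⁻¹) ∧
  (∀ i j, p (genBF n (.wpinv i)) (genBE n (.winv j)) = cstB n i j) ∧
  (∀ i j, p (genBF n (.f i)) (genBE n (.w j)) = 0) ∧
  (∀ i j, p (genBF n (.f i)) (genBE n (.winv j)) = 0) ∧
  (∀ i j, p (genBF n (.wp i)) (genBE n (.e j)) = 0) ∧
  (∀ i j, p (genBF n (.wpinv i)) (genBE n (.e j)) = 0)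

section TwistedAdjoint
variable {K A C : Type*} [CommRing K] [Ring A] [Algebra K A] [Ring C] [Algebra K C]

/-- Iterated twisted commutators: the operators `y ↦ x * y - c k • (y * x)` for `k < m`,
applied successively. -/
def adSeq (c : ℕ → K) (x y : A) : ℕ → A
  | 0 => y
  | k + 1 => x * adSeq c x y k - c k • (adSeq c x y k * x)

/-- The quantum Serre expression `(ad_q x)^m y`. -/
def qSerre (l q : K) (m : ℕ) (x y : A) : A := adSeq (fun k => l * q ^ k) x y m

lemma map_adSeq (φ : A →ₐ[K] C) (c : ℕ → K) (x y : A) (m : ℕ) :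
    φ (adSeq c x y m) = adSeq c (φ x) (φ y) m := by
  induction m with
  | zero => rfl
  | succ m ih => simp [adSeq, ih]

lemma map_qSerre (φ : A →ₐ[K] C) (l q : K) (m : ℕ) (x y : A) :
    φ (qSerre l q m x y) = qSerre l q m (φ x) (φ y) := map_adSeq ..

lemma adSeq_add (c : ℕ → K) (x y y' : A) (m : ℕ) :
    adSeq c x (y + y') m = adSeq c x y m + adSeq c x y' m := by
  induction m with
  | zero => rfl
  | succ m ih => simp only [adSeq, ih, mul_add, add_mul, smul_add]; abel

lemma adSeq_smul (c : ℕ → K) (x y : A) (α β : K) (m : ℕ) :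
    adSeq c (α • x) (β • y) m = (α ^ m * β) • adSeq c x y m := by
  induction m with
  | zero => simp [adSeq]
  | succ m ih =>
    simp only [adSeq, ih, smul_mul_assoc, mul_smul_comm, smul_sub, smul_smul]
    congr 2 <;> ring

lemma qSerre_smul (l q : K) (m : ℕ) (x y : A) (α β : K) :
    qSerre l q m (α • x) (β • y) = (α ^ m * β) • qSerre l q m x y := adSeq_smul ..

lemma adSeq_comm (c : ℕ → K) (x y : A) (d : K) (m : ℕ) :
    adSeq c x (x * y - d • (y * x)) m = x * adSeq c x y m - d • (adSeq c x y m * x) := by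
  induction m with
  | zero => rfl
  | succ m ih =>
    simp only [adSeq, ih, mul_sub, sub_mul, smul_sub, mul_smul_comm, smul_mul_assoc, mul_assoc,
      smul_smul, mul_comm d]
    abel

lemma adSeq_succ' (c : ℕ → K) (x y : A) (m : ℕ) :
    adSeq c x y (m + 1) = adSeq (fun k => c (k + 1)) x (x * y - c 0 • (y * x)) m := by
  induction m with
  | zero => rfl
  | succ m ih => rw [adSeq, ih]; rfl

lemma adSeq_reverse (c : ℕ → K) (x y : A) (m : ℕ) :
    adSeq (fun k => c (m - 1 - k)) x y m = adSeq c x y m := by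
  induction m generalizing y with
  | zero => rfl
  | succ m ih =>
    rw [adSeq_succ', show (fun k => c (m + 1 - 1 - (k + 1))) = fun k => c (m - 1 - k) from
      funext fun k => by congr 1; omega, ih]
    simp only [Nat.add_sub_cancel, Nat.sub_zero, adSeq_comm]
    rfl

lemma qSerre_eq_reverse (l q : K) (m : ℕ) (x y : A) :
    qSerre l q m x y = adSeq (fun k => l * q ^ (m - 1 - k)) x y m :=
  (adSeq_reverse (fun k => l * q ^ k) x y m).symm

lemma qSerre_zero (l q : K) (m : ℕ) : qSerre l q m (0 : A) 0 = 0 := by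
  simpa using qSerre_smul l q m (0 : A) 0 0 0

lemma qSerre_eq_zero_of_mul {x y : A} (l q : K) {m : ℕ} (hm : m ≠ 0) (h : x * y = 0)
    (h' : y * x = 0) : qSerre l q m x y = 0 := by
  obtain ⟨m, rfl⟩ := Nat.exists_eq_succ_of_ne_zero hm
  have h0 (c : ℕ → K) : adSeq c x 0 m = 0 := by
    induction m with
    | zero => rfl
    | succ m ih => simp [adSeq, ih]
  rw [qSerre, Nat.succ_eq_add_one, adSeq_succ', h, h', smul_zero, sub_zero, h0]

/-- Additivity of the quantum Serre expression on `q`-commuting pairs. -/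
lemma qSerre_add {l q μ : K} {m : ℕ} (hq : l * μ * q ^ (m - 1) = 1) {x x' y y' : A}
    (h1 : y * x = q • (x * y)) (h2 : y * x' = l • (x' * y)) (h3 : y' * x = μ • (x * y')) :
    qSerre l q m (x + y) (x' + y') = qSerre l q m x x' + qSerre l q m y y' := by
  have e1 (k : ℕ) : adSeq (fun k => l * q ^ k) (x + y) x' k = adSeq (fun k => l * q ^ k) x x' k ∧
      y * adSeq (fun k => l * q ^ k) x x' k
        = (l * q ^ k) • (adSeq (fun k => l * q ^ k) x x' k * y) := by
    induction k with
    | zero => simpa [adSeq] using h2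
    | succ k ih =>
      set z := adSeq (fun k => l * q ^ k) x x' k
      constructor
      · simp only [adSeq]
        rw [ih.1, add_mul, ih.2, mul_add, smul_add]
        abel
      · simp only [adSeq]
        change y * (x * z - _ • (z * x)) = _ • ((x * z - _ • (z * x)) * y)
        rw [mul_sub, ← mul_assoc, h1, mul_smul_comm, ← mul_assoc y, ih.2]
        simp only [smul_mul_assoc, mul_assoc, ih.2, h1, mul_smul_comm, sub_mul, smul_sub, smul_smul]
        congr 2 <;> ring
  have e2 (k : ℕ) (hk : k ≤ m) : adSeq (fun k => l * q ^ (m - 1 - k)) (x + y) y' k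
        = adSeq (fun k => l * q ^ (m - 1 - k)) y y' k ∧
      adSeq (fun k => l * q ^ (m - 1 - k)) y y' k * x
        = (μ * q ^ k) • (x * adSeq (fun k => l * q ^ (m - 1 - k)) y y' k) := by
    induction k with
    | zero => simpa [adSeq] using h3
    | succ k ih =>
      specialize ih (by omega)
      have hk : l * q ^ (m - 1 - k) * (μ * q ^ k) = 1 := by
        rw [← hq, show m - 1 = m - 1 - k + k by omega, pow_add]
        simp only [Nat.add_sub_cancel]
        ring
      set z := adSeq (fun k => l * q ^ (m - 1 - k)) y y' k
      constructor
      · simp only [adSeq]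
        rw [ih.1, add_mul, mul_add, ih.2, smul_add, smul_smul, hk, one_smul]
        abel
      · simp only [adSeq]
        change (y * z - _ • (z * y)) * x = _ • (x * (y * z - _ • (z * y)))
        have h4 : z * (y * x) = (μ * q ^ (k + 1)) • (x * (z * y)) := by
          rw [h1, mul_smul_comm, ← mul_assoc, ih.2, smul_mul_assoc, smul_smul, mul_assoc x]
          congr 1; ring
        have h5 : y * (z * x) = (μ * q ^ (k + 1)) • (x * (y * z)) := by
          rw [ih.2, mul_smul_comm, ← mul_assoc, h1, smul_mul_assoc, smul_smul, mul_assoc x]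
          congr 1; ring
        rw [sub_mul, smul_mul_assoc, mul_assoc, mul_assoc, h4, h5, mul_sub, mul_smul_comm, smul_sub,
          smul_comm (l * _)]
  rw [qSerre, adSeq_add, (e1 m).1, ← qSerre, ← qSerre, qSerre_eq_reverse _ _ _ (x + y),
    (e2 m le_rfl).1, ← qSerre_eq_reverse]

end TwistedAdjoint

section Borel
variable {K I : Type} [Field K]

/-- The relations of a Borel subalgebra with skew generators `e`, toral generators `w` with inverses
`v`, braiding matrix `a` and a Serre relation of order `m` on `e i`, `e j` whenever `S i j m`. -/
structure BorelRel {A : Type} [Ring A] [Algebra K A] (a : I → I → K) (S : I → I → ℕ → Prop)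
    (e w v : I → A) : Prop where
  comm : ∀ i j, w i * w j = w j * w i
  wv : ∀ i, w i * v i = 1
  vw : ∀ i, v i * w i = 1
  we : ∀ i j, w i * e j = a i j • (e j * w i)
  serre : ∀ i j m, S i j m → qSerre (a i j) (a i i) m (e i) (e j) = 0

/-- The compatibility of the orders of the Serre relations with the braiding matrix. -/
def SerreCompat (a : I → I → K) (S : I → I → ℕ → Prop) : Prop :=
  ∀ i j m, S i j m → m ≠ 0 ∧ a i j * a j i * a i i ^ (m - 1) = 1

/-- `B` is the algebra presented by the relations `BorelRel a S`. -/
structure IsBorel (a : I → I → K) (S : I → I → ℕ → Prop) {B : Type} [Ring B] [Algebra K B]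
    (e w v : I → B) : Prop extends BorelRel a S e w v where
  adjoin_eq_top : Algebra.adjoin K (Set.range e ∪ Set.range w ∪ Set.range v) = ⊤
  exists_lift : ∀ {A : Type} [Ring A] [Algebra K A] (e' w' v' : I → A), BorelRel a S e' w' v' →
    ∃ φ : B →ₐ[K] A, (∀ i, φ (e i) = e' i) ∧ (∀ i, φ (w i) = w' i) ∧ (∀ i, φ (v i) = v' i)

variable {a : I → I → K} {S : I → I → ℕ → Prop}

namespace BorelRel
variable {A : Type} [Ring A] [Algebra K A] {e w v : I → A}

lemma ev (h : BorelRel a S e w v) (i j : I) : e j * v i = a i j • (v i * e j) := by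
  calc e j * v i = v i * (w i * e j) * v i := by rw [← mul_assoc, h.vw, one_mul]
    _ = _ := by rw [h.we, mul_smul_comm, smul_mul_assoc, mul_assoc, mul_assoc, h.wv, mul_one]

lemma vw_comm (h : BorelRel a S e w v) (i j : I) : v i * w j = w j * v i := by
  calc v i * w j = v i * (w j * w i) * v i := by rw [mul_assoc, mul_assoc, h.wv, mul_one]
    _ = _ := by rw [← h.comm, ← mul_assoc, h.vw, one_mul]

lemma vv_comm (h : BorelRel a S e w v) (i j : I) : v i * v j = v j * v i := by
  calc v i * v j = v i * (v j * w i) * v i := by rw [mul_assoc, mul_assoc, h.wv, mul_one]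
    _ = _ := by rw [h.vw_comm j i, ← mul_assoc, h.vw, one_mul]

/-- The quantum Serre expression of the coproducts `e ⊗ 1 + w ⊗ e`. -/
lemma qSerre_comul (hw : ∀ i j, w i * w j = w j * w i)
    (he : ∀ i j, w i * e j = a i j • (e j * w i)) {i j : I} {m : ℕ}
    (hm : a i j * a j i * a i i ^ (m - 1) = 1) :
    qSerre (a i j) (a i i) m (e i ⊗ₜ[K] (1 : A) + w i ⊗ₜ[K] e i) (e j ⊗ₜ[K] 1 + w j ⊗ₜ[K] e j)
      = qSerre (a i j) (a i i) m (e i) (e j) ⊗ₜ[K] 1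
        + (w i ^ m * w j) ⊗ₜ[K] qSerre (a i j) (a i i) m (e i) (e j) := by
  rw [qSerre_add hm]
  · congr 1
    · exact (map_qSerre (Algebra.TensorProduct.includeLeft : A →ₐ[K] A ⊗[K] A) _ _ _ _ _).symm
    · unfold qSerre
      generalize (fun k => a i j * a i i ^ k) = c
      have hc (m : ℕ) : w i * (w i ^ m * w j) = w i ^ (m + 1) * w j ∧
          w i ^ m * w j * w i = w i ^ (m + 1) * w j := by
        constructor
        · rw [← mul_assoc, pow_succ']
        · rw [mul_assoc, hw j i, ← mul_assoc, pow_succ]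
      clear hm
      induction m with
      | zero => simp [adSeq]
      | succ m ih =>
        simp only [adSeq, ih, Algebra.TensorProduct.tmul_mul_tmul, (hc m).1, (hc m).2,
          TensorProduct.tmul_sub, TensorProduct.tmul_smul]
  all_goals simp [he, TensorProduct.smul_tmul']
end BorelRel

lemma IsBorel.induction {B : Type} [Ring B] [Algebra K B] {e w v : I → B}
    (hB : IsBorel a S e w v) {P : B → Prop} (he : ∀ i, P (e i)) (hw : ∀ i, P (w i))
    (hv : ∀ i, P (v i)) (halg : ∀ k : K, P (algebraMap K B k))
    (hadd : ∀ x y, P x → P y → P (x + y)) (hmul : ∀ x y, P x → P y → P (x * y)) (x : B) : P x := by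
  have hx : x ∈ Algebra.adjoin K (Set.range e ∪ Set.range w ∪ Set.range v) := by
    rw [hB.adjoin_eq_top]; trivial
  induction hx using Algebra.adjoin_induction with
  | mem x hx =>
    rcases hx with (⟨i, rfl⟩ | ⟨i, rfl⟩) | ⟨i, rfl⟩
    exacts [he i, hw i, hv i]
  | algebraMap k => exact halg k
  | add x y _ _ hx hy => exact hadd x y hx hy
  | mul x y _ _ hx hy => exact hmul x y hx hy

lemma IsBorel.algHom_ext {B A : Type} [Ring B] [Algebra K B] {e w v : I → B}
    (hB : IsBorel a S e w v) [Semiring A] [Algebra K A] {φ ψ : B →ₐ[K] A}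
    (he : ∀ i, φ (e i) = ψ (e i)) (hw : ∀ i, φ (w i) = ψ (w i))
    (hv : ∀ i, φ (v i) = ψ (v i)) : φ = ψ := by
  ext x
  refine hB.induction (P := fun x => φ x = ψ x) he hw hv (fun k => by simp) ?_ ?_ x
  · intro x y hx hy; rw [map_add, map_add, hx, hy]
  · intro x y hx hy; rw [map_mul, map_mul, hx, hy]

namespace BorelRel
variable {A : Type} [Ring A] [Algebra K A] {e w v : I → A}

lemma comul (h : BorelRel a S e w v) (hS : SerreCompat a S) :
    BorelRel a S (fun i => e i ⊗ₜ[K] (1 : A) + w i ⊗ₜ[K] e i) (fun i => w i ⊗ₜ[K] w i)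
      (fun i => v i ⊗ₜ[K] v i) where
  comm i j := by simp [h.comm i j]
  wv i := by simp [h.wv, Algebra.TensorProduct.one_def]
  vw i := by simp [h.vw, Algebra.TensorProduct.one_def]
  we i j := by
    simp [mul_add, add_mul, h.we, h.comm i j, TensorProduct.smul_tmul']
  serre i j m hm := by
    rw [qSerre_comul h.comm h.we (hS i j m hm).2, h.serre i j m hm]
    simp

lemma antipode (h : BorelRel a S e w v) (hS : SerreCompat a S) (κ : I → K) :
    BorelRel a S (fun i => MulOpposite.op (κ i • (v i * e i))) (fun i => MulOpposite.op (v i))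
      (fun i => MulOpposite.op (w i)) where
  comm i j := by rw [← MulOpposite.op_mul, ← MulOpposite.op_mul, h.vv_comm]
  wv i := by rw [← MulOpposite.op_mul, h.wv, MulOpposite.op_one]
  vw i := by rw [← MulOpposite.op_mul, h.vw, MulOpposite.op_one]
  we i j := by
    rw [← MulOpposite.op_mul, ← MulOpposite.op_mul, ← MulOpposite.op_smul, smul_mul_assoc,
      mul_smul_comm, mul_assoc, h.ev, mul_smul_comm, ← mul_assoc, h.vv_comm j i, mul_assoc,
      smul_comm]
  serre i j m hm := by
    have hpow (k : ℕ) : e i * v i ^ k = a i i ^ k • (v i ^ k * e i) := by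
      induction k with
      | zero => simp
      | succ k ih =>
        rw [pow_succ, ← mul_assoc, ih, smul_mul_assoc, mul_assoc, h.ev, mul_smul_comm, smul_smul,
          ← pow_succ, mul_assoc]
    have key (k : ℕ) (hk : k ≤ m) : ∃ α : K, adSeq (fun k => a i j * a i i ^ k)
        (MulOpposite.op (v i * e i)) (MulOpposite.op (v j * e j)) k = α • MulOpposite.op
          (v i ^ k * v j * adSeq (fun k => a i j * a i i ^ (m - 1 - k)) (e i) (e j) k) ∧
        adSeq (fun k => a i j * a i i ^ (m - 1 - k)) (e i) (e j) k * v i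
          = (a i j * a i i ^ k) •
            (v i * adSeq (fun k => a i j * a i i ^ (m - 1 - k)) (e i) (e j) k) := by
      induction k with
      | zero => exact ⟨1, by simp [adSeq], by simpa [adSeq] using h.ev i j⟩
      | succ k ih =>
        obtain ⟨α, h1, h2⟩ := ih (by omega)
        have hα : a i j * a i i ^ (m - 1 - k) * (a j i * a i i ^ k) = 1 := by
          rw [← (hS i j m hm).2, show m - 1 = m - 1 - k + k by omega, pow_add]
          simp only [Nat.add_sub_cancel]
          ring
        set s := adSeq (fun k => a i j * a i i ^ (m - 1 - k)) (e i) (e j) k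
        refine ⟨-α * (a i j * a i i ^ k) * (a j i * a i i ^ k), ?_, ?_⟩
        · have hV : e i * (v i ^ k * v j) = (a j i * a i i ^ k) • (v i ^ k * v j * e i) := by
            rw [← mul_assoc, hpow, smul_mul_assoc, mul_assoc, h.ev, mul_smul_comm, smul_smul,
              mul_assoc, mul_comm]
          have h3 : v i ^ k * v j * s * (v i * e i)
              = (a i j * a i i ^ k) • (v i ^ (k + 1) * v j * (s * e i)) := by
            rw [← mul_assoc, mul_assoc _ s, h2, mul_smul_comm, smul_mul_assoc, ← mul_assoc,
              mul_assoc _ (v j), h.vv_comm j i, ← mul_assoc, ← pow_succ, mul_assoc _ s]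
          have h4 : v i * e i * (v i ^ k * v j * s)
              = (a j i * a i i ^ k) • (v i ^ (k + 1) * v j * (e i * s)) := by
            rw [mul_assoc, ← mul_assoc (e i), hV, smul_mul_assoc, mul_smul_comm, pow_succ']
            simp only [mul_assoc]
          simp only [adSeq, h1, mul_smul_comm, smul_mul_assoc, ← MulOpposite.op_mul, h3, h4]
          simp only [← MulOpposite.op_smul, ← MulOpposite.op_sub, mul_sub, mul_smul_comm]
          congr 1
          match_scalars
          · linear_combination (a i j * a i i ^ k * α) * (- hα)
          · ring
        · change (e i * s - _ • (s * e i)) * v i = _ • (v i * (e i * s - _ • (s * e i)))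
          have h3 : e i * s * v i = (a i j * a i i ^ (k + 1)) • (v i * (e i * s)) := by
            rw [mul_assoc, h2, mul_smul_comm, ← mul_assoc, h.ev, smul_mul_assoc, smul_smul,
              mul_assoc (v i)]
            congr 1; ring
          have h4 : s * e i * v i = (a i j * a i i ^ (k + 1)) • (v i * (s * e i)) := by
            rw [mul_assoc, h.ev, mul_smul_comm, ← mul_assoc, h2, smul_mul_assoc, smul_smul,
              mul_assoc (v i)]
            congr 1; ring
          rw [sub_mul, smul_mul_assoc, h3, h4, mul_sub, mul_smul_comm, smul_sub, smul_comm]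
    obtain ⟨α, h1, -⟩ := key m le_rfl
    rw [MulOpposite.op_smul, MulOpposite.op_smul, qSerre_smul, qSerre, h1, ← qSerre_eq_reverse,
      h.serre i j m hm]
    simp
end BorelRel
end Borel

section Convolution
open WithConv
variable (K : Type) {B : Type} [Field K] [Ring B] [Bialgebra K B]

/-- The convolution algebra of linear functionals on a bialgebra. -/
abbrev ConvDual (K B : Type) [Field K] [Ring B] [Bialgebra K B] : Type := WithConv (B →ₗ[K] K)

variable (B) in
/-- A functional on `B` viewed as a functional on `B ⊗ B` through the multiplication. -/
def ConvDual.comulHom : ConvDual K B →ₐ[K] ConvDual K (B ⊗[K] B) :=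
  AlgHom.ofLinearMap
    { toFun := fun f => toConv (f.ofConv ∘ₗ LinearMap.mul' K B)
      map_add' := fun _ _ => rfl
      map_smul' := fun _ _ => rfl }
    (by
      ext x y
      exact (Bialgebra.counit_mul x y).trans (mul_comm _ _))
    (fun f g => congrArg toConv
      (LinearMap.convMul_comp_coalgHom_distrib f g (Bialgebra.mulCoalgHom K B)))

lemma ConvDual.comulHom_apply (f : ConvDual K B) (x y : B) :
    ConvDual.comulHom K B f (x ⊗ₜ y) = f (x * y) := rfl

variable (B) in
/-- The external product of functionals. -/
def ConvDual.tensorHom : ConvDual K B ⊗[K] ConvDual K B →ₐ[K] ConvDual K (B ⊗[K] B) :=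
  Algebra.TensorProduct.algHomOfLinearMapTensorProduct
    (TensorProduct.lift (LinearMap.mk₂ K
      (fun f g : ConvDual K B =>
        (toConv (LinearMap.mul' K K ∘ₗ TensorProduct.map f.ofConv g.ofConv) :
          ConvDual K (B ⊗[K] B)))
      (fun f f' g => by ext x y; simp [add_mul])
      (fun c f g => by ext x y; simp [mul_assoc])
      (fun f g g' => by ext x y; simp [mul_add])
      (fun c f g => by ext x y; simp [mul_left_comm])))
    (fun f f' g g' => by
      have h1 := TensorProduct.map_convMul_map (R := K) (f := f) (g := g) (h := f') (k := g')
      have h2 := LinearMap.algHom_comp_convMul_distrib (Algebra.TensorProduct.lmul' K (S := K))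
        (toConv (TensorProduct.map f.ofConv g.ofConv))
        (toConv (TensorProduct.map f'.ofConv g'.ofConv))
      rw [h1] at h2
      exact congrArg toConv h2)
    (by ext x y; simp [TensorProduct.counit_tmul, mul_comm])

lemma ConvDual.tensorHom_apply (f g : ConvDual K B) (x y : B) :
    ConvDual.tensorHom K B (f ⊗ₜ g) (x ⊗ₜ y) = f x * g y := rfl

lemma ConvDual.ext_tmul {f g : ConvDual K (B ⊗[K] B)} (h : ∀ x y, f (x ⊗ₜ y) = g (x ⊗ₜ y)) :
    f = g := by
  ext x y
  exact h x y

/-- A skew derivation with respect to arbitrary functions vanishes if it vanishes on generators. -/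
lemma IsBorel.functional_eq_zero {K I : Type} [Field K] {a : I → I → K} {S : I → I → ℕ → Prop}
    {B : Type} [Ring B] [Bialgebra K B] {e w v : I → B} (hB : IsBorel a S e w v)
    {f g h : ConvDual K B}
    (hf : ConvDual.comulHom K B f = ConvDual.tensorHom K B (g ⊗ₜ f + f ⊗ₜ h)) (h1 : f 1 = 0)
    (he : ∀ i, f (e i) = 0) (hw : ∀ i, f (w i) = 0) (hv : ∀ i, f (v i) = 0) : f = 0 := by
  ext x
  refine hB.induction (P := fun x => f x = 0) he hw hv ?_ ?_ ?_ x
  · intro k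
    rw [Algebra.algebraMap_eq_smul_one]
    exact (map_smul f.ofConv k 1).trans (by rw [show f.ofConv 1 = 0 from h1, smul_zero])
  · intro x y hx hy
    exact (map_add f.ofConv x y).trans (by rw [show f.ofConv x = 0 from hx,
      show f.ofConv y = 0 from hy, add_zero])
  · intro x y hx hy
    rw [← ConvDual.comulHom_apply, hf, map_add]
    change ConvDual.tensorHom K B (g ⊗ₜ f) (x ⊗ₜ y) + ConvDual.tensorHom K B (f ⊗ₜ h) (x ⊗ₜ y) = 0
    rw [ConvDual.tensorHom_apply, ConvDual.tensorHom_apply, hx, hy, mul_zero, zero_mul, add_zero]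

lemma ConvDual.mul_apply_groupLike {K : Type} {B : Type} [Field K] [Ring B] [Bialgebra K B]
    (f g : ConvDual K B) {x : B} (hx : CoalgebraStruct.comul (R := K) x = x ⊗ₜ x) :
    (f * g) x = f x * g x := by
  simp [LinearMap.convMul_apply, hx]

lemma ConvDual.mul_apply_skew {K : Type} {B : Type} [Field K] [Ring B] [Bialgebra K B]
    (f g : ConvDual K B) {x y : B} (hx : CoalgebraStruct.comul (R := K) x = x ⊗ₜ 1 + y ⊗ₜ x) :
    (f * g) x = f x * g 1 + f y * g x := by
  simp [LinearMap.convMul_apply, hx]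

end Convolution

section Functionals

lemma map_qSerre_of_map_comul {K I A C : Type} [Field K] [Ring A] [Algebra K A] [Ring C]
    [Algebra K C] {a : I → I → K} (φ : A →ₐ[K] C) (ψ : A ⊗[K] A →ₐ[K] C) {x g : I → A}
    (hg : ∀ i j, g i * g j = g j * g i) (hx : ∀ i j, g i * x j = a i j • (x j * g i)) {i j : I}
    {m : ℕ} (hm : a i j * a j i * a i i ^ (m - 1) = 1)
    (hi : φ (x i) = ψ (x i ⊗ₜ 1 + g i ⊗ₜ x i)) (hj : φ (x j) = ψ (x j ⊗ₜ 1 + g j ⊗ₜ x j)) :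
    φ (qSerre (a i j) (a i i) m (x i) (x j))
      = ψ ((g i ^ m * g j) ⊗ₜ qSerre (a i j) (a i i) m (x i) (x j)
        + qSerre (a i j) (a i i) m (x i) (x j) ⊗ₜ 1) := by
  rw [map_qSerre, hi, hj, ← map_qSerre, BorelRel.qSerre_comul hg hx hm, add_comm]

lemma ConvDual.adSeq_apply_groupLike {K B : Type} [Field K] [Ring B] [Bialgebra K B]
    {f g : ConvDual K B} {x : B} (hx : CoalgebraStruct.comul (R := K) x = x ⊗ₜ x) (hf : f x = 0)
    (hg : g x = 0) (c : ℕ → K) (m : ℕ) : adSeq c f g m x = 0 := by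
  cases m with
  | zero => exact hg
  | succ m =>
    refine (?_ : (f * adSeq c f g m) x - c m • (adSeq c f g m * f) x = 0)
    rw [ConvDual.mul_apply_groupLike _ _ hx, ConvDual.mul_apply_groupLike _ _ hx, hf]
    simp

lemma ConvDual.adSeq_apply_skew {K B : Type} [Field K] [Ring B] [Bialgebra K B]
    {f g : ConvDual K B} {x y : B} (hy : CoalgebraStruct.comul (R := K) y = y ⊗ₜ y)
    (hx : CoalgebraStruct.comul (R := K) x = x ⊗ₜ 1 + y ⊗ₜ x) (hf1 : f 1 = 0) (hg1 : g 1 = 0)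
    (hfy : f y = 0) (hgy : g y = 0) (c : ℕ → K) {m : ℕ} (hm : m ≠ 0) : adSeq c f g m x = 0 := by
  obtain ⟨m, rfl⟩ := Nat.exists_eq_succ_of_ne_zero hm
  refine (?_ : (f * adSeq c f g m) x - c m • (adSeq c f g m * f) x = 0)
  rw [ConvDual.mul_apply_skew _ _ hx, ConvDual.mul_apply_skew _ _ hx, hf1, hfy,
    ConvDual.adSeq_apply_groupLike Bialgebra.comul_one hf1 hg1,
    ConvDual.adSeq_apply_groupLike hy hfy hgy]
  simp

variable {K I : Type} [Field K] {a : I → I → K} {S : I → I → ℕ → Prop}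

lemma BorelRel.of_toral (t : I → K) (ht : ∀ i, t i ≠ 0) :
    BorelRel a S (fun _ => (0 : K)) t (fun i => (t i)⁻¹) where
  comm i j := mul_comm _ _
  wv i := mul_inv_cancel₀ (ht i)
  vw i := inv_mul_cancel₀ (ht i)
  we i j := by simp
  serre i j m _ := qSerre_zero ..

open Matrix in
lemma BorelRel.of_matrix [DecidableEq I] (ha : ∀ i j, a i j ≠ 0) (hS : SerreCompat a S) (d : K)
    (i : I) :
    BorelRel a S (fun j => !![0, if i = j then d else 0; 0, 0]) (fun j => !![a j i, 0; 0, 1])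
      (fun j => !![(a j i)⁻¹, 0; 0, 1]) where
  comm j k := by simp [mul_comm]
  wv j := by simp [ha, Matrix.one_fin_two]
  vw j := by simp [ha, Matrix.one_fin_two]
  we j k := by
    by_cases h : i = k
    · subst h; simp
    · simp [h]
  serre j k m hm := by
    apply qSerre_eq_zero_of_mul _ _ (hS j k m hm).1 <;> ext x y <;> fin_cases x <;> fin_cases y <;>
      simp <;> split_ifs <;> rfl

variable {B : Type} [Ring B] [Bialgebra K B] {e w v : I → B}

lemma IsBorel.exists_character (hB : IsBorel a S e w v) (t : I → K) (ht : ∀ i, t i ≠ 0) :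
    ∃ X : B →ₐ[K] K, (∀ j, X (e j) = 0) ∧ (∀ j, X (w j) = t j) ∧ ∀ j, X (v j) = (t j)⁻¹ :=
  hB.exists_lift _ _ _ (BorelRel.of_toral t ht)

/-- The functionals dual to the generators `e i`. -/
lemma IsBorel.exists_skewDerivation [DecidableEq I] (hB : IsBorel a S e w v)
    (ha : ∀ i j, a i j ≠ 0) (hS : SerreCompat a S)
    (hεe : ∀ i, CoalgebraStruct.counit (R := K) (e i) = 0)
    (hεw : ∀ i, CoalgebraStruct.counit (R := K) (w i) = 1)
    (hεv : ∀ i, CoalgebraStruct.counit (R := K) (v i) = 1)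
    (d : K) (i : I) {X : B →ₐ[K] K} (hXe : ∀ j, X (e j) = 0) (hXw : ∀ j, X (w j) = a j i)
    (hXv : ∀ j, X (v j) = (a j i)⁻¹) :
    ∃ N : B →ₗ[K] K, (∀ j, N (e j) = if i = j then d else 0) ∧ (∀ j, N (w j) = 0) ∧
      (∀ j, N (v j) = 0) ∧ N 1 = 0 ∧
      ∀ x y, N (x * y) = X x * N y + N x * CoalgebraStruct.counit (R := K) y := by
  obtain ⟨ρ, he, hw, hv⟩ := hB.exists_lift _ _ _ (BorelRel.of_matrix ha hS d i)
  have key (x : B) : ρ x 0 0 = X x ∧ ρ x 1 0 = 0 ∧ ρ x 1 1 = CoalgebraStruct.counit (R := K) x := by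
    refine hB.induction (P := fun x => ρ x 0 0 = X x ∧ ρ x 1 0 = 0 ∧
      ρ x 1 1 = CoalgebraStruct.counit (R := K) x) ?_ ?_ ?_ ?_ ?_ ?_ x
    · simp [he, hXe, hεe]
    · simp [hw, hXw, hεw]
    · simp [hv, hXv, hεv]
    · simp [Matrix.algebraMap_matrix_apply]
    · rintro x y ⟨h1, h2, h3⟩ ⟨h4, h5, h6⟩
      simp [h1, h2, h3, h4, h5, h6]
    · rintro x y ⟨h1, h2, h3⟩ ⟨h4, h5, h6⟩
      simp [Matrix.mul_apply, h1, h2, h3, h4, h5, h6]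
  refine ⟨Matrix.entryLinearMap K K 0 1 ∘ₗ ρ.toLinearMap, ?_, ?_, ?_, ?_, ?_⟩
  · simp [he]
  · simp [hw]
  · simp [hv]
  · simp
  · intro x y
    simp [Matrix.mul_apply, key]

open WithConv

/-- The coproduct of a twisted commutator of a group-like and a skew primitive element. -/
lemma groupLike_commutator_comul {A : Type} [Ring A] [Algebra K A] {x y : A} (hxy : x * y = y * x)
    (z : A) (c : K) :
    (x ⊗ₜ[K] x) * (z ⊗ₜ[K] 1 + y ⊗ₜ[K] z) - c • ((z ⊗ₜ[K] 1 + y ⊗ₜ[K] z) * (x ⊗ₜ[K] x))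
      = (x * y) ⊗ₜ[K] (x * z - c • (z * x)) + (x * z - c • (z * x)) ⊗ₜ[K] x := by
  simp only [mul_add, add_mul, Algebra.TensorProduct.tmul_mul_tmul, mul_one, one_mul,
    TensorProduct.tmul_sub, TensorProduct.sub_tmul, smul_add, TensorProduct.tmul_smul,
    TensorProduct.smul_tmul', hxy]
  abel

/-- The functionals dual to the generators of `B` satisfy the relations of the Borel algebra with
the transposed braiding matrix. -/
lemma IsBorel.borelRel_dual [DecidableEq I] (hB : IsBorel a S e w v)
    (ha : ∀ i j, a i j ≠ 0) (hS : SerreCompat a S) (hS' : SerreCompat (fun i j => a j i) S)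
    (hΔe : ∀ i, CoalgebraStruct.comul (R := K) (e i) = e i ⊗ₜ 1 + w i ⊗ₜ e i)
    (hΔw : ∀ i, CoalgebraStruct.comul (R := K) (w i) = w i ⊗ₜ w i)
    (hΔv : ∀ i, CoalgebraStruct.comul (R := K) (v i) = v i ⊗ₜ v i)
    (hεe : ∀ i, CoalgebraStruct.counit (R := K) (e i) = 0)
    (hεw : ∀ i, CoalgebraStruct.counit (R := K) (w i) = 1)
    (hεv : ∀ i, CoalgebraStruct.counit (R := K) (v i) = 1) (d : I → K) :
    ∃ η χ ψ : I → ConvDual K B, BorelRel (fun i j => a j i) S η χ ψ ∧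
      (∀ i, ConvDual.comulHom K B (η i) = ConvDual.tensorHom K B (η i ⊗ₜ 1 + χ i ⊗ₜ η i)) ∧
      (∀ i, ConvDual.comulHom K B (χ i) = ConvDual.tensorHom K B (χ i ⊗ₜ χ i)) ∧
      (∀ i, ConvDual.comulHom K B (ψ i) = ConvDual.tensorHom K B (ψ i ⊗ₜ ψ i)) ∧
      (∀ i, η i 1 = 0 ∧ χ i 1 = 1 ∧ ψ i 1 = 1) ∧
      (∀ i j, η i (e j) = if i = j then d i else 0) ∧ (∀ i j, η i (w j) = 0) ∧
      (∀ i j, η i (v j) = 0) ∧ (∀ i j, χ i (e j) = 0) ∧ (∀ i j, χ i (w j) = a j i) ∧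
      (∀ i j, χ i (v j) = (a j i)⁻¹) ∧ (∀ i j, ψ i (e j) = 0) ∧
      (∀ i j, ψ i (w j) = (a j i)⁻¹) ∧ (∀ i j, ψ i (v j) = a j i) := by
  choose X hXe hXw hXv using fun i => hB.exists_character (fun j => a j i) (fun j => ha j i)
  choose Y hYe hYw hYv using
    fun i => hB.exists_character (fun j => (a j i)⁻¹) (fun j => inv_ne_zero (ha j i))
  choose N hNe hNw hNv hN1 hN using fun i =>
    hB.exists_skewDerivation ha hS hεe hεw hεv (d i) i (hXe i) (hXw i) (hXv i)
  set η : I → ConvDual K B := fun i => toConv (N i)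
  set χ : I → ConvDual K B := fun i => toConv (X i).toLinearMap
  set ψ : I → ConvDual K B := fun i => toConv (Y i).toLinearMap
  have Mη (i) : ConvDual.comulHom K B (η i) = ConvDual.tensorHom K B (η i ⊗ₜ 1 + χ i ⊗ₜ η i) := by
    refine ConvDual.ext_tmul K fun x y => ?_
    rw [map_add, add_comm]
    exact hN i x y
  have Mχ (i) : ConvDual.comulHom K B (χ i) = ConvDual.tensorHom K B (χ i ⊗ₜ χ i) :=
    ConvDual.ext_tmul K fun x y => map_mul (X i) x y
  have Mψ (i) : ConvDual.comulHom K B (ψ i) = ConvDual.tensorHom K B (ψ i ⊗ₜ ψ i) :=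
    ConvDual.ext_tmul K fun x y => map_mul (Y i) x y
  have conv_eq {X X' Y Y' : B →ₐ[K] K} (he : ∀ i, X (e i) = 0 ∧ X' (e i) = 0 ∧ Y (e i) = 0 ∧
      Y' (e i) = 0) (hw : ∀ i, X (w i) * X' (w i) = Y (w i) * Y' (w i))
      (hv : ∀ i, X (v i) * X' (v i) = Y (v i) * Y' (v i)) :
      (toConv X.toLinearMap * toConv X'.toLinearMap : ConvDual K B)
        = toConv Y.toLinearMap * toConv Y'.toLinearMap := by
    have : (toConv X * toConv X' : WithConv (B →ₐ[K] K)) = toConv Y * toConv Y' := by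
      apply ofConv_injective
      refine hB.algHom_ext (fun i => ?_) (fun i => ?_) (fun i => ?_)
      · change (toConv X * toConv X' : WithConv (B →ₐ[K] K)) (e i) = (toConv Y * toConv Y') (e i)
        simp [AlgHom.convMul_apply, hΔe, he]
      · change (toConv X * toConv X' : WithConv (B →ₐ[K] K)) (w i) = (toConv Y * toConv Y') (w i)
        simp [AlgHom.convMul_apply, hΔw, hw]
      · change (toConv X * toConv X' : WithConv (B →ₐ[K] K)) (v i) = (toConv Y * toConv Y') (v i)
        simp [AlgHom.convMul_apply, hΔv, hv]
    have h2 := congrArg (fun F : WithConv (B →ₐ[K] K) => toConv F.ofConv.toLinearMap) this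
    simpa using h2
  have one_eq : (1 : ConvDual K B) = toConv (Bialgebra.counitAlgHom K B).toLinearMap := rfl
  have hχχ (i j) : χ i * χ j = χ j * χ i :=
    conv_eq (by simp [hXe]) (fun k => mul_comm _ _) (fun k => mul_comm _ _)
  have hη1 (i) : η i 1 = 0 := hN1 i
  have hηw (i k) : η i (w k) = 0 := hNw i k
  have hηv (i k) : η i (v k) = 0 := hNv i k
  have hηe (i k) : η i (e k) = if i = k then d i else 0 := hNe i k
  have hχe (i k) : χ i (e k) = 0 := hXe i k
  have hχw (i k) : χ i (w k) = a k i := hXw i k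
  have hχ1 (i) : χ i 1 = 1 := map_one (X i)
  have h1mul (f g : ConvDual K B) : (f * g) 1 = f 1 * g 1 :=
    ConvDual.mul_apply_groupLike f g (Bialgebra.comul_one)
  have hwmul (k) (f g : ConvDual K B) : (f * g) (w k) = f (w k) * g (w k) :=
    ConvDual.mul_apply_groupLike f g (hΔw k)
  have hvmul (k) (f g : ConvDual K B) : (f * g) (v k) = f (v k) * g (v k) :=
    ConvDual.mul_apply_groupLike f g (hΔv k)
  have hemul (k) (f g : ConvDual K B) : (f * g) (e k) = f (e k) * g 1 + f (w k) * g (e k) :=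
    ConvDual.mul_apply_skew f g (hΔe k)
  have hχη (i j) : χ i * η j = a j i • (η j * χ i) := by
    rw [← sub_eq_zero]
    refine hB.functional_eq_zero (g := χ i * χ j) (h := χ i) ?_ ?_ ?_ ?_ ?_
    · rw [map_sub, map_smul, map_mul, map_mul, Mη, Mχ, ← map_mul, ← map_mul, ← map_smul, ← map_sub]
      exact congrArg _ (groupLike_commutator_comul (hχχ i j) (η j) (a j i))
    · exact (by rw [h1mul, h1mul, hη1, mul_zero, zero_mul, smul_zero, sub_zero] :
        (χ i * η j) 1 - a j i • (η j * χ i) 1 = 0)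
    · intro k
      refine (?_ : (χ i * η j) (e k) - a j i • (η j * χ i) (e k) = 0)
      rw [hemul, hemul, hη1, hηw, hχe, hχ1, hχw, hηe]
      split_ifs with hjk
      · subst hjk; simp
      · simp
    · intro k
      exact (by rw [hwmul, hwmul, hηw, mul_zero, zero_mul, smul_zero, sub_zero] :
        (χ i * η j) (w k) - a j i • (η j * χ i) (w k) = 0)
    · intro k
      exact (by rw [hvmul, hvmul, hηv, mul_zero, zero_mul, smul_zero, sub_zero] :
        (χ i * η j) (v k) - a j i • (η j * χ i) (v k) = 0)
  refine ⟨η, χ, ψ, ⟨hχχ, ?_, ?_, hχη, ?_⟩, Mη, Mχ, Mψ, ?_, hNe, hNw, hNv, hXe, hXw, hXv, hYe, hYw,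
    fun i j => (hYv i j).trans (inv_inv _)⟩
  · intro i
    have h := conv_eq (X := X i) (X' := Y i) (Y := Bialgebra.counitAlgHom K B)
      (Y' := Bialgebra.counitAlgHom K B) (by simp [hXe, hYe, hεe]) (by simp [hXw, hYw, ha, hεw])
      (by simp [hXv, hYv, ha, hεv])
    rwa [← one_eq, one_mul] at h
  · intro i
    have h := conv_eq (X := Y i) (X' := X i) (Y := Bialgebra.counitAlgHom K B)
      (Y' := Bialgebra.counitAlgHom K B) (by simp [hXe, hYe, hεe]) (by simp [hXw, hYw, ha, hεw])
      (by simp [hXv, hYv, ha, hεv])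
    rwa [← one_eq, one_mul] at h
  · intro i j m hm
    refine hB.functional_eq_zero (g := χ i ^ m * χ j) (h := 1) ?_ ?_ ?_ ?_ ?_
    · exact map_qSerre_of_map_comul (a := fun i j => a j i) (ConvDual.comulHom K B)
        (ConvDual.tensorHom K B) hχχ hχη (hS' i j m hm).2 (Mη i) (Mη j)
    · exact ConvDual.adSeq_apply_groupLike Bialgebra.comul_one (hη1 i) (hη1 j) _ m
    · exact fun k => ConvDual.adSeq_apply_skew (hΔw k) (hΔe k) (hη1 i) (hη1 j) (hηw i k)
        (hηw j k) _ (hS' i j m hm).1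
    · exact fun k => ConvDual.adSeq_apply_groupLike (hΔw k) (hηw i k) (hηw j k) _ m
    · exact fun k => ConvDual.adSeq_apply_groupLike (hΔv k) (hηv i k) (hηv j k) _ m
  · intro i
    exact ⟨hN1 i, map_one (X i), map_one (Y i)⟩

end Functionals

section Hopf
variable {K I : Type} [Field K] {a : I → I → K} {S : I → I → ℕ → Prop}

/-- The coalgebra structure of a Borel subalgebra on its generators. -/
structure BorelCoalg {B : Type} [Ring B] [Algebra K B] (e w v : I → B) (Δ : B →ₐ[K] B ⊗[K] B)
    (ε : B →ₐ[K] K) : Prop where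
  comul_e : ∀ i, Δ (e i) = e i ⊗ₜ 1 + w i ⊗ₜ e i
  comul_w : ∀ i, Δ (w i) = w i ⊗ₜ w i
  comul_v : ∀ i, Δ (v i) = v i ⊗ₜ v i
  counit_e : ∀ i, ε (e i) = 0
  counit_w : ∀ i, ε (w i) = 1
  counit_v : ∀ i, ε (v i) = 1

/-- An antimultiplicative map given on the generators by `e i ↦ κ i • (v i * e i)` and by
inversion of the toral elements. -/
structure BorelAntipode {B : Type} [Ring B] [Algebra K B] (e w v : I → B) (κ : I → K)
    (σ : B →ₗ[K] B) : Prop where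
  map_one : σ 1 = 1
  map_mul : ∀ x y, σ (x * y) = σ y * σ x
  map_w : ∀ i, σ (w i) = v i
  map_v : ∀ i, σ (v i) = w i
  map_e : ∀ i, σ (e i) = κ i • (v i * e i)

section Existence
variable {B : Type} [Ring B] [Algebra K B] {e w v : I → B}

lemma IsBorel.exists_coalg (hB : IsBorel a S e w v) (hS : SerreCompat a S) :
    ∃ (Δ : B →ₐ[K] B ⊗[K] B) (ε : B →ₐ[K] K), BorelCoalg e w v Δ ε := by
  obtain ⟨Δ, hΔe, hΔw, hΔv⟩ := hB.exists_lift _ _ _ (hB.toBorelRel.comul hS)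
  obtain ⟨ε, hεe, hεw, hεv⟩ :=
    hB.exists_lift _ _ _ (BorelRel.of_toral (a := a) (S := S) (fun _ => (1 : K)) (by simp))
  exact ⟨Δ, ε, hΔe, hΔw, hΔv, hεe, hεw, by simpa using hεv⟩

lemma IsBorel.exists_antipode (hB : IsBorel a S e w v) (hS : SerreCompat a S) (κ : I → K) :
    ∃ σ : B →ₗ[K] B, BorelAntipode e w v κ σ := by
  obtain ⟨φ, he, hw, hv⟩ := hB.exists_lift _ _ _ (hB.toBorelRel.antipode hS κ)
  refine ⟨(MulOpposite.opLinearEquiv K).symm.toLinearMap ∘ₗ φ.toLinearMap, ?_, ?_, ?_, ?_, ?_⟩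
  · simp
  · simp
  · simp [hw]
  · simp [hv]
  · simp [he]

/-- The bialgebra structure on a Borel subalgebra. -/
abbrev IsBorel.bialgebra (hB : IsBorel a S e w v) {Δ : B →ₐ[K] B ⊗[K] B} {ε : B →ₐ[K] K}
    (h : BorelCoalg e w v Δ ε) : Bialgebra K B :=
  Bialgebra.ofAlgHom Δ ε
    (hB.algHom_ext (by simp [h.comul_e, h.comul_w, TensorProduct.add_tmul, TensorProduct.tmul_add,
        Algebra.TensorProduct.one_def, add_assoc])
      (by simp [h.comul_w]) (by simp [h.comul_v]))
    (hB.algHom_ext (by simp [h.comul_e, h.counit_e, h.counit_w])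
      (by simp [h.comul_w, h.counit_w]) (by simp [h.comul_v, h.counit_v]))
    (hB.algHom_ext (by simp [h.comul_e, h.counit_e])
      (by simp [h.comul_w, h.counit_w]) (by simp [h.comul_v, h.counit_v]))

lemma BorelAntipode.counit (hB : IsBorel a S e w v) {Δ : B →ₐ[K] B ⊗[K] B} {ε : B →ₐ[K] K}
    (h : BorelCoalg e w v Δ ε) {κ : I → K} {σ : B →ₗ[K] B} (hσ : BorelAntipode e w v κ σ) (x : B) :
    ε (σ x) = ε x := by
  refine hB.induction (P := fun x => ε (σ x) = ε x) ?_ ?_ ?_ ?_ ?_ ?_ x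
  · simp [hσ.map_e, h.counit_e]
  · simp [hσ.map_w, h.counit_w, h.counit_v]
  · simp [hσ.map_v, h.counit_w, h.counit_v]
  · intro k
    rw [Algebra.algebraMap_eq_smul_one, map_smul, hσ.map_one]
  · intro x y hx hy
    rw [map_add, map_add, map_add, hx, hy]
  · intro x y hx hy
    rw [hσ.map_mul, _root_.map_mul, _root_.map_mul, hx, hy, mul_comm]

lemma BorelAntipode.comul (hB : IsBorel a S e w v) {Δ : B →ₐ[K] B ⊗[K] B} {ε : B →ₐ[K] K}
    (h : BorelCoalg e w v Δ ε) {κ : I → K} {σ : B →ₗ[K] B} (hσ : BorelAntipode e w v κ σ) (x : B) :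
    Δ (σ x) = TensorProduct.map σ σ (TensorProduct.comm K B B (Δ x)) := by
  have hmul (s t : B ⊗[K] B) : TensorProduct.map σ σ (TensorProduct.comm K B B (s * t))
      = TensorProduct.map σ σ (TensorProduct.comm K B B t)
        * TensorProduct.map σ σ (TensorProduct.comm K B B s) := by
    induction s with
    | zero => simp
    | add s s' hs hs' => rw [add_mul, map_add, map_add, hs, hs', map_add, map_add, mul_add]
    | tmul x y =>
      induction t with
      | zero => simp
      | add t t' ht ht' => rw [mul_add, map_add, map_add, ht, ht', map_add, map_add, add_mul]
      | tmul x' y' => simp [hσ.map_mul]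
  refine hB.induction (P := fun x => Δ (σ x) = TensorProduct.map σ σ
    (TensorProduct.comm K B B (Δ x))) ?_ ?_ ?_ ?_ ?_ ?_ x
  · intro i
    simp [hσ.map_e, h.comul_e, h.comul_v, hσ.map_one, hσ.map_w, mul_add, hB.vw, smul_add,
      TensorProduct.smul_tmul', add_comm]
  · intro i
    simp [hσ.map_w, h.comul_w, h.comul_v]
  · intro i
    simp [hσ.map_v, h.comul_w, h.comul_v]
  · intro k
    simp only [Algebra.algebraMap_eq_smul_one, map_smul, hσ.map_one, _root_.map_one]
    simp [Algebra.TensorProduct.one_def, hσ.map_one]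
  · intro x y hx hy
    simp only [map_add, hx, hy]
  · intro x y hx hy
    rw [hσ.map_mul, _root_.map_mul, _root_.map_mul, hx, hy, hmul]

end Existence

variable {H B : Type} [Ring H] [Algebra K H] [Ring B] [Algebra K B]

/-- A dual pairing of the bialgebras `(H, Δ', ε')` and `(B, Δ, ε)`. -/
structure IsDualPairing (Δ' : H →ₐ[K] H ⊗[K] H) (ε' : H →ₐ[K] K) (Δ : B →ₐ[K] B ⊗[K] B)
    (ε : B →ₐ[K] K) (p : H →ₗ[K] B →ₗ[K] K) : Prop where
  apply_one : ∀ x, p x 1 = ε' x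
  one_apply : ∀ b, p 1 b = ε b
  apply_mul : ∀ x b b', p x (b * b')
    = LinearMap.mul' K K (TensorProduct.map (p.flip b) (p.flip b') (Δ' x))
  mul_apply : ∀ x x' b, p (x * x') b = LinearMap.mul' K K (TensorProduct.map (p x) (p x') (Δ b))

/-- The values on generators of the pairing of two Borel subalgebras. -/
structure PairingValues [DecidableEq I] (a : I → I → K) (d : I → K) (e' w' v' : I → H)
    (e w v : I → B) (p : H →ₗ[K] B →ₗ[K] K) : Prop where
  ee : ∀ i j, p (e' i) (e j) = if i = j then d i else 0
  ew : ∀ i j, p (e' i) (w j) = 0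
  ev : ∀ i j, p (e' i) (v j) = 0
  we : ∀ i j, p (w' i) (e j) = 0
  ww : ∀ i j, p (w' i) (w j) = a j i
  wv : ∀ i j, p (w' i) (v j) = (a j i)⁻¹
  ve : ∀ i j, p (v' i) (e j) = 0
  vw : ∀ i j, p (v' i) (w j) = (a j i)⁻¹
  vv : ∀ i j, p (v' i) (v j) = a j i

variable {a' : I → I → K} {e w v : I → B} {e' w' v' : I → H} {Δ' : H →ₐ[K] H ⊗[K] H}
  {ε' : H →ₐ[K] K} {Δ : B →ₐ[K] B ⊗[K] B} {ε : B →ₐ[K] K}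

namespace IsDualPairing
variable {p : H →ₗ[K] B →ₗ[K] K}

lemma apply_mul_groupLike (hp : IsDualPairing Δ' ε' Δ ε p) {x : H} (hx : Δ' x = x ⊗ₜ x)
    (b b' : B) :
    p x (b * b') = p x b * p x b' := by
  simp [hp.apply_mul, hx]

lemma apply_mul_skew (hp : IsDualPairing Δ' ε' Δ ε p) {x y : H}
    (hx : Δ' x = x ⊗ₜ 1 + y ⊗ₜ x) (b b' : B) :
    p x (b * b') = p x b * ε b' + p y b * p x b' := by
  simp [hp.apply_mul, hx, hp.one_apply]

lemma mul_apply_groupLike (hp : IsDualPairing Δ' ε' Δ ε p) {b : B} (hb : Δ b = b ⊗ₜ b)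
    (x x' : H) :
    p (x * x') b = p x b * p x' b := by
  simp [hp.mul_apply, hb]

lemma ext (hp : IsDualPairing Δ' ε' Δ ε p) (h' : BorelCoalg e' w' v' Δ' ε')
    (hH : IsBorel a' S e' w' v') (hB : IsBorel a S e w v) [DecidableEq I] {c : I → I → K}
    {d : I → K} (hv : PairingValues c d e' w' v' e w v p) {q : H →ₗ[K] B →ₗ[K] K}
    (hq : IsDualPairing Δ' ε' Δ ε q) (hv' : PairingValues c d e' w' v' e w v q) : p = q := by
  have key (b : B) : ∀ i, p (e' i) b = q (e' i) b ∧ p (w' i) b = q (w' i) b ∧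
      p (v' i) b = q (v' i) b := by
    refine hB.induction (P := fun b => ∀ i, p (e' i) b = q (e' i) b ∧ p (w' i) b = q (w' i) b ∧
      p (v' i) b = q (v' i) b) ?_ ?_ ?_ ?_ ?_ ?_ b
    · intro j i
      simp [hv.ee, hv'.ee, hv.we, hv'.we, hv.ve, hv'.ve]
    · intro j i
      simp [hv.ew, hv'.ew, hv.ww, hv'.ww, hv.vw, hv'.vw]
    · intro j i
      simp [hv.ev, hv'.ev, hv.wv, hv'.wv, hv.vv, hv'.vv]
    · intro k i
      simp [Algebra.algebraMap_eq_smul_one, hp.apply_one, hq.apply_one]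
    · intro b b' hb hb' i
      simp [hb i, hb' i]
    · intro b b' hb hb' i
      simp [hp.apply_mul_groupLike (h'.comul_w i), hq.apply_mul_groupLike (h'.comul_w i),
        hp.apply_mul_groupLike (h'.comul_v i), hq.apply_mul_groupLike (h'.comul_v i),
        hp.apply_mul_skew (h'.comul_e i), hq.apply_mul_skew (h'.comul_e i), hb i, hb' i]
  ext1 x
  refine hH.induction (P := fun x => p x = q x) ?_ ?_ ?_ ?_ ?_ ?_ x
  · exact fun i => LinearMap.ext fun b => (key b i).1
  · exact fun i => LinearMap.ext fun b => (key b i).2.1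
  · exact fun i => LinearMap.ext fun b => (key b i).2.2
  · intro k
    ext b
    simp [Algebra.algebraMap_eq_smul_one, hp.one_apply, hq.one_apply]
  · intro x y hx hy
    simp [hx, hy]
  · intro x y hx hy
    ext b
    rw [hp.mul_apply, hq.mul_apply, hx, hy]

end IsDualPairing

/-- The composite of a dual pairing with the antipodes is again a dual pairing. -/
lemma IsDualPairing.comp_antipode {p : H →ₗ[K] B →ₗ[K] K} (hp : IsDualPairing Δ' ε' Δ ε p)
    (hH : IsBorel a' S e' w' v') (hB : IsBorel a S e w v) (h' : BorelCoalg e' w' v' Δ' ε')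
    (h : BorelCoalg e w v Δ ε) {κ' κ : I → K} {σ' : H →ₗ[K] H} {σ : B →ₗ[K] B}
    (hσ' : BorelAntipode e' w' v' κ' σ') (hσ : BorelAntipode e w v κ σ) :
    IsDualPairing Δ' ε' Δ ε (p.compl₁₂ σ' σ) where
  apply_one x := by simp [hσ.map_one, hp.apply_one, hσ'.counit hH h']
  one_apply b := by simp [hσ'.map_one, hp.one_apply, hσ.counit hB h]
  apply_mul x b b' := by
    simp only [LinearMap.compl₁₂_apply, hσ.map_mul, hp.apply_mul, hσ'.comul hH h']
    induction Δ' x with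
    | zero => simp
    | add s t hs ht => simp only [map_add, hs, ht]
    | tmul s t => simp [mul_comm]
  mul_apply x x' b := by
    simp only [LinearMap.compl₁₂_apply, hσ'.map_mul, hp.mul_apply, hσ.comul hB h]
    induction Δ b with
    | zero => simp
    | add s t hs ht => simp only [map_add, hs, ht]
    | tmul s t => simp [mul_comm]

/-- The pairing of two Borel subalgebras is invariant under the antipodes. -/
lemma IsDualPairing.antipode_apply [DecidableEq I] {d : I → K} {p : H →ₗ[K] B →ₗ[K] K}
    (hp : IsDualPairing Δ' ε' Δ ε p) (hv : PairingValues a d e' w' v' e w v p)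
    (ha : ∀ i j, a i j ≠ 0)
    (hH : IsBorel a' S e' w' v') (hB : IsBorel a S e w v) (h' : BorelCoalg e' w' v' Δ' ε')
    (h : BorelCoalg e w v Δ ε) {κ' κ : I → K} (hκ : ∀ i, κ' i * κ i = a i i)
    {σ' : H →ₗ[K] H} {σ : B →ₗ[K] B}
    (hσ' : BorelAntipode e' w' v' κ' σ') (hσ : BorelAntipode e w v κ σ) (x : H) (b : B) :
    p (σ' x) (σ b) = p x b := by
  have hq : PairingValues a d e' w' v' e w v (p.compl₁₂ σ' σ) := by
    have hwv (i j) : p (v' i) (v j * e j) = 0 := by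
      rw [hp.apply_mul_groupLike (h'.comul_v i), hv.ve, mul_zero]
    constructor <;> intro i j
    · have h1 : p (e' i) (v j * e j) = (a j i)⁻¹ * if i = j then d i else 0 := by
        rw [hp.apply_mul_skew (h'.comul_e i), hv.ev, hv.ee, hv.wv, zero_mul, zero_add]
      have h2 : Δ (v j * e j) = (v j * e j) ⊗ₜ v j + 1 ⊗ₜ (v j * e j) := by
        simp [h.comul_v, h.comul_e, mul_add, hB.vw]
      simp only [LinearMap.compl₁₂_apply, hσ'.map_e, hσ.map_e, map_smul, LinearMap.smul_apply,
        hp.mul_apply, h2]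
      simp only [map_add, TensorProduct.map_tmul, LinearMap.mul'_apply, hwv, hp.apply_one,
        h'.counit_v, h1]
      split_ifs with hij
      · subst hij
        have := ha i i
        simp only [smul_eq_mul]
        field_simp
        linear_combination d i * hκ i
      · simp
    · simp [hσ'.map_e, hσ.map_w, hp.mul_apply_groupLike (h.comul_v j), hv.ev]
    · simp [hσ'.map_e, hσ.map_v, hp.mul_apply_groupLike (h.comul_w j), hv.ew]
    · simp [hσ'.map_w, hσ.map_e, hwv]
    · simp [hσ'.map_w, hσ.map_w, hv.vv]
    · simp [hσ'.map_w, hσ.map_v, hv.vw]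
    · simp [hσ'.map_v, hσ.map_e, hp.apply_mul_groupLike (h'.comul_w i), hv.we]
    · simp [hσ'.map_v, hσ.map_w, hv.wv]
    · simp [hσ'.map_v, hσ.map_v, hv.ww]
  exact congrArg (fun r : H →ₗ[K] B →ₗ[K] K => r x b)
    ((hp.comp_antipode hH hB h' h hσ' hσ).ext h' hH hB hq hp hv)

open WithConv in
/-- Two Borel subalgebras with transposed braiding matrices are dually paired. -/
lemma IsBorel.exists_pairing [DecidableEq I] (ha : ∀ i j, a i j ≠ 0) (hS : SerreCompat a S)
    (hS' : SerreCompat (fun i j => a j i) S) (d : I → K)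
    (hH : IsBorel (fun i j => a j i) S e' w' v') (hB : IsBorel a S e w v)
    (h' : BorelCoalg e' w' v' Δ' ε') (h : BorelCoalg e w v Δ ε) :
    ∃ p : H →ₗ[K] B →ₗ[K] K, IsDualPairing Δ' ε' Δ ε p ∧ PairingValues a d e' w' v' e w v p := by
  let _ := hB.bialgebra h
  obtain ⟨η, χ, ψ, hrel, Mη, Mχ, Mψ, h1, hηe, hηw, hηv, hχe, hχw, hχv, hψe, hψw, hψv⟩ :=
    hB.borelRel_dual ha hS hS' h.comul_e h.comul_w h.comul_v h.counit_e h.counit_w h.counit_v d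
  obtain ⟨φ, he, hw, hv⟩ := hH.exists_lift η χ ψ hrel
  have hcomul : (ConvDual.comulHom K B).comp φ
      = ((ConvDual.tensorHom K B).comp (Algebra.TensorProduct.map φ φ)).comp Δ' := by
    refine hH.algHom_ext (fun i => ?_) (fun i => ?_) (fun i => ?_)
    · simp [he, hw, h'.comul_e, Mη]
    · simp [hw, h'.comul_w, Mχ]
    · simp [hv, h'.comul_v, Mψ]
  let ev1 : ConvDual K B →ₐ[K] K := AlgHom.ofLinearMap
    { toFun := fun f => f 1
      map_add' := fun _ _ => rfl
      map_smul' := fun _ _ => rfl } (map_one ε)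
    (fun f g => ConvDual.mul_apply_groupLike f g Bialgebra.comul_one)
  have hone : ev1.comp φ = ε' := by
    refine hH.algHom_ext (fun i => ?_) (fun i => ?_) (fun i => ?_)
    · rw [h'.counit_e, AlgHom.comp_apply, he]; exact (h1 i).1
    · rw [h'.counit_w, AlgHom.comp_apply, hw]; exact (h1 i).2.1
    · rw [h'.counit_v, AlgHom.comp_apply, hv]; exact (h1 i).2.2
  let p : H →ₗ[K] B →ₗ[K] K :=
    { toFun := fun x => (φ x).ofConv
      map_add' := fun x y => by rw [map_add]; rfl
      map_smul' := fun c x => by rw [map_smul]; rfl }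
  refine ⟨p, ⟨fun x => DFunLike.congr_fun hone x, fun b => ?_, fun x b b' => ?_, fun x x' b => ?_⟩,
    ?_⟩
  · change φ 1 b = ε b
    rw [map_one]
    rfl
  · refine (congrArg (fun f : ConvDual K (B ⊗[K] B) => f (b ⊗ₜ b'))
      (DFunLike.congr_fun hcomul x)).trans ?_
    change ConvDual.tensorHom K B (Algebra.TensorProduct.map φ φ (Δ' x)) (b ⊗ₜ b') = _
    induction Δ' x with
    | zero => simp
    | add s t hs ht =>
      rw [map_add, map_add, map_add, map_add, ← hs, ← ht]
      rfl
    | tmul s t => simp [p, ConvDual.tensorHom_apply]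
  · change φ (x * x') b = _
    rw [map_mul]
    rfl
  · constructor <;> intro i j
    · exact (congrArg (fun f : ConvDual K B => f (e j)) (he i)).trans (hηe i j)
    · exact (congrArg (fun f : ConvDual K B => f (w j)) (he i)).trans (hηw i j)
    · exact (congrArg (fun f : ConvDual K B => f (v j)) (he i)).trans (hηv i j)
    · exact (congrArg (fun f : ConvDual K B => f (e j)) (hw i)).trans (hχe i j)
    · exact (congrArg (fun f : ConvDual K B => f (w j)) (hw i)).trans (hχw i j)
    · exact (congrArg (fun f : ConvDual K B => f (v j)) (hw i)).trans (hχv i j)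
    · exact (congrArg (fun f : ConvDual K B => f (e j)) (hv i)).trans (hψe i j)
    · exact (congrArg (fun f : ConvDual K B => f (w j)) (hv i)).trans (hψw i j)
    · exact (congrArg (fun f : ConvDual K B => f (v j)) (hv i)).trans (hψv i j)

end Hopf

section Serre
variable {K A : Type*} [CommRing K] [Ring A] [Algebra K A]

lemma qSerre_one (l q : K) (x y : A) : qSerre l q 1 x y = x * y - l • (y * x) := by
  simp [qSerre, adSeq]

lemma qSerre_two (l q : K) (x y : A) : qSerre l q 2 x y
    = x ^ 2 * y - (l + l * q) • (x * y * x) + (l * (l * q)) • (y * x ^ 2) := by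
  simp only [qSerre, adSeq, mul_sub, sub_mul, mul_smul_comm, smul_mul_assoc, mul_assoc, pow_succ,
    pow_zero, one_mul, mul_one]
  module

lemma qSerre_three (l q : K) (x y : A) : qSerre l q 3 x y
    = x ^ 3 * y - (l * (1 + q + q ^ 2)) • (x ^ 2 * y * x)
      + (l ^ 2 * q * (1 + q + q ^ 2)) • (x * y * x ^ 2) - (l ^ 3 * q ^ 3) • (y * x ^ 3) := by
  simp only [qSerre, adSeq, mul_sub, sub_mul, mul_smul_comm, smul_mul_assoc, mul_assoc, pow_succ,
    pow_zero, one_mul, mul_one]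
  module

lemma smul_qSerre_two {l q c α : K} (h1 : c * (l + l * q) = α) (h2 : c * (l * (l * q)) = 1)
    (x y : A) : y * x ^ 2 - α • (x * y * x) + c • (x ^ 2 * y) = c • qSerre l q 2 x y := by
  rw [qSerre_two, smul_add, smul_sub, smul_smul, smul_smul, h1, h2, one_smul]
  abel

lemma smul_qSerre_three {l q c α β : K} (h1 : c * (l * (1 + q + q ^ 2)) = β)
    (h2 : c * (l ^ 2 * q * (1 + q + q ^ 2)) = α) (h3 : c * (l ^ 3 * q ^ 3) = 1) (x y : A) :
    y * x ^ 3 - α • (x * y * x ^ 2) + β • (x ^ 2 * y * x) - c • (x ^ 3 * y)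
      = (-c) • qSerre l q 3 x y := by
  rw [qSerre_three, smul_sub, smul_add, smul_sub, neg_smul, neg_smul, neg_smul, neg_smul,
    smul_smul, smul_smul, smul_smul, h1, h2, h3, one_smul]
  abel

end Serre

lemma RingQuot.adjoin_range_mkAlgHom {K X : Type} [CommRing K]
    (r : FreeAlgebra K X → FreeAlgebra K X → Prop) :
    Algebra.adjoin K (Set.range fun x => RingQuot.mkAlgHom K r (FreeAlgebra.ι K x)) = ⊤ := by
  have := congrArg (Subalgebra.map (RingQuot.mkAlgHom K r)) (FreeAlgebra.adjoin_range_ι K X)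
  rwa [AlgHom.map_adjoin, ← Set.range_comp, Algebra.map_top,
    (AlgHom.range_eq_top _).2 (RingQuot.mkAlgHom_surjective K r)] at this

section Parameters

lemma qr_ne_zero : qr ≠ 0 := by
  simp [qr]

lemma qs_ne_zero : qs ≠ 0 := by
  simp [qs]

variable {n : ℕ} {i j : Fin (n + 1)}

lemma cstB_ne_zero (i j : Fin (n + 1)) : cstB n i j ≠ 0 := by
  have := qr_ne_zero
  have := qs_ne_zero
  unfold cstB
  split_ifs <;> positivity

lemma cstB_self (h : (i : ℕ) < n) : cstB n i i = qr ^ 2 * (qs ^ 2)⁻¹ := by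
  simp [cstB, ipaB, h]

lemma cstB_last : cstB n (Fin.last n) (Fin.last n) = qr * qs⁻¹ := by
  simp [cstB]

lemma cstB_succ (h : (j : ℕ) = i + 1) : cstB n j i = qs ^ 2 := by
  have hi : (i : ℕ) < n := by omega
  simp only [cstB, ipaB, h, hi]
  split_ifs <;> first | omega | (norm_num; try norm_cast)

lemma cstB_pred (h : (j : ℕ) = i + 1) : cstB n i j = (qr ^ 2)⁻¹ := by
  have hi : (i : ℕ) < n := by omega
  simp only [cstB, ipaB, h, hi]
  split_ifs <;> first | omega | (norm_num; try norm_cast)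

lemma cstB_far (h : (i : ℕ) + 1 < j ∨ (j : ℕ) + 1 < i) : cstB n i j = 1 := by
  simp only [cstB, ipaB]
  split_ifs <;> first | omega | norm_num

lemma index_cases (i j : Fin (n + 1)) :
    i = j ∨ (j : ℕ) = i + 1 ∨ (i : ℕ) = j + 1 ∨ ((i : ℕ) + 1 < j ∨ (j : ℕ) + 1 < i) := by
  rw [Fin.ext_iff]
  omega

lemma weight_e (hj : (j : ℕ) < n) :
    (riB n qr j) ^ (ipaB n j i) * (riB n qs j) ^ (ipaB n ((j : ℕ) + 1) i) = cstB n i j := by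
  simp only [cstB, riB, hj, if_true, zpow_mul]
  norm_cast

lemma weight_e_last (hi : (i : ℕ) < n) :
    (riB n qr n) ^ (2 * ipaB n n i) = cstB n i (Fin.last n) := by
  simp [cstB, riB, hi]

lemma weight_e_last_last : riB n qr n * (riB n qs n)⁻¹ = cstB n (Fin.last n) (Fin.last n) := by
  simp [cstB, riB]

lemma weight_f (hj : (j : ℕ) < n) :
    (riB n qs j) ^ (-(ipaB n j i)) * (riB n qr j) ^ (-(ipaB n ((j : ℕ) + 1) i)) = cstB n j i := by
  have hr := qr_ne_zero
  have hs := qs_ne_zero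
  rcases index_cases i j with rfl | h | h | h
  · rw [cstB_self hj]
    simp [riB, ipaB, hj, mul_comm]
  · rw [cstB_succ h]
    have hi : (i : ℕ) + 1 < n := by omega
    simp [riB, ipaB, h, hi, show (i : ℕ) < n by omega, show (i : ℕ) + 1 + 1 ≠ i by omega]
  · rw [cstB_pred h]
    simp only [riB, ipaB, h, hj]
    split_ifs <;> first | omega | norm_num
  · rw [cstB_far h.symm]
    simp only [riB, ipaB, hj]
    split_ifs <;> first | omega | norm_num

lemma weight_f_last (hi : (i : ℕ) < n) :
    (riB n qs n) ^ (-(2 * ipaB n n i)) = cstB n (Fin.last n) i := by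
  rcases index_cases i (Fin.last n) with rfl | h | h | h
  · simp at hi
  · rw [cstB_succ h]
    simp only [riB, ipaB, hi]
    split_ifs <;> simp_all
  · simp at h; omega
  · rw [cstB_far h.symm]
    simp only [riB, ipaB, hi]
    simp only [Fin.val_last] at h
    split_ifs <;> first | omega | norm_num

lemma weight_f_last_last : (riB n qs n)⁻¹ * riB n qr n = cstB n (Fin.last n) (Fin.last n) := by
  simp [cstB, riB, mul_comm]

/-- The orders of the Serre relations of type `B`. -/
def SerreB (n : ℕ) (i j : Fin (n + 1)) (m : ℕ) : Prop :=
  (m = 1 ∧ ((i : ℕ) + 1 < j ∨ (j : ℕ) + 1 < i)) ∨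
  (m = 2 ∧ ((j : ℕ) = i + 1 ∨ ((i : ℕ) = j + 1 ∧ (i : ℕ) < n))) ∨
  (m = 3 ∧ i = Fin.last n ∧ (j : ℕ) + 1 = n)

lemma serreCompat_cstB : SerreCompat (cstB n) (SerreB n) := by
  have hr := qr_ne_zero
  have hs := qs_ne_zero
  rintro i j m (⟨rfl, h⟩ | ⟨rfl, h | ⟨h, hi⟩⟩ | ⟨rfl, rfl, h⟩)
  · simp [cstB_far h, cstB_far h.symm]
  · rw [cstB_pred h, cstB_succ h, cstB_self (by omega)]
    refine ⟨two_ne_zero, ?_⟩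
    norm_num
    field_simp
  · rw [cstB_pred h, cstB_succ h, cstB_self hi]
    refine ⟨two_ne_zero, ?_⟩
    norm_num
    field_simp
  · have h' : (Fin.last n : ℕ) = j + 1 := h.symm
    rw [cstB_pred h', cstB_succ h', cstB_last]
    refine ⟨three_ne_zero, ?_⟩
    norm_num
    field_simp

lemma SerreCompat.swap {K I : Type} [Field K] {a : I → I → K} {S : I → I → ℕ → Prop}
    (h : SerreCompat a S) : SerreCompat (fun i j => a j i) S :=
  fun i j m hm => ⟨(h i j m hm).1, by rw [mul_comm (a j i)]; exact (h i j m hm).2⟩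

variable {A : Type} [Ring A] [Algebra KK A] (x y : A)

lemma serre_far (h : (i : ℕ) + 1 < j ∨ (j : ℕ) + 1 < i) (q : KK) :
    qSerre (cstB n i j) q 1 x y = x * y - y * x := by
  rw [qSerre_one, cstB_far h, one_smul]

lemma serre_e_succ (h : (j : ℕ) = i + 1) : qSerre (cstB n j i) (cstB n i i) 2 x y
    = x ^ 2 * y - (riB n qr i + riB n qs i) • (x * y * x)
      + (riB n qr i * riB n qs i) • (y * x ^ 2) := by
  have hs := qs_ne_zero
  have hi : (i : ℕ) < n := by omega
  rw [qSerre_two, cstB_succ h, cstB_self hi]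
  simp only [riB, hi, if_true]
  rw [add_comm (qr ^ 2), mul_comm (qr ^ 2) (qs ^ 2)]
  congr 3 <;> field_simp

lemma serre_e_pred (h : (j : ℕ) = i + 1) (hj : (i : ℕ) + 1 < n) :
    qSerre (cstB n i j) (cstB n j j) 2 x y
    = x ^ 2 * y - ((riB n qr ((i : ℕ) + 1))⁻¹ + (riB n qs ((i : ℕ) + 1))⁻¹) • (x * y * x)
      + (riB n qr ((i : ℕ) + 1) * riB n qs ((i : ℕ) + 1))⁻¹ • (y * x ^ 2) := by
  have hr := qr_ne_zero
  have hs := qs_ne_zero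
  rw [qSerre_two, cstB_pred h, cstB_self (by omega)]
  simp only [riB, hj, if_true]
  congr 3 <;> field_simp

lemma serre_e_last (h : (i : ℕ) + 1 = n) :
    qSerre (cstB n i (Fin.last n)) (cstB n (Fin.last n) (Fin.last n)) 3 x y
    = x ^ 3 * y - (qr ^ (-2 : ℤ) + qr⁻¹ * qs⁻¹ + qs ^ (-2 : ℤ)) • (x ^ 2 * y * x)
      + ((qr * qs)⁻¹ * (qr ^ (-2 : ℤ) + qr⁻¹ * qs⁻¹ + qs ^ (-2 : ℤ))) • (x * y * x ^ 2)
      - (qr * qs) ^ (-3 : ℤ) • (y * x ^ 3) := by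
  have hr := qr_ne_zero
  have hs := qs_ne_zero
  have h' : (Fin.last n : ℕ) = i + 1 := h.symm
  rw [qSerre_three, cstB_pred h', cstB_last]
  congr 3 <;> field_simp

lemma serre_f_succ (h : (j : ℕ) = i + 1) :
    y * x ^ 2 - (riB n qr i + riB n qs i) • (x * y * x) + (riB n qr i * riB n qs i) • (x ^ 2 * y)
      = (riB n qr i * riB n qs i) • qSerre (cstB n i j) (cstB n i i) 2 x y := by
  have hr := qr_ne_zero
  have hs := qs_ne_zero
  have hi : (i : ℕ) < n := by omega
  rw [cstB_pred h, cstB_self hi]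
  simp only [riB, hi, if_true]
  apply smul_qSerre_two <;> field_simp
  ring

lemma serre_f_pred (h : (j : ℕ) = i + 1) (hj : (i : ℕ) + 1 < n) :
    y * x ^ 2 - ((riB n qr ((i : ℕ) + 1))⁻¹ + (riB n qs ((i : ℕ) + 1))⁻¹) • (x * y * x)
      + (riB n qr ((i : ℕ) + 1) * riB n qs ((i : ℕ) + 1))⁻¹ • (x ^ 2 * y)
      = (riB n qr ((i : ℕ) + 1) * riB n qs ((i : ℕ) + 1))⁻¹ •
        qSerre (cstB n j i) (cstB n j j) 2 x y := by
  have hr := qr_ne_zero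
  have hs := qs_ne_zero
  rw [cstB_succ h, cstB_self (by omega)]
  simp only [riB, hj, if_true]
  apply smul_qSerre_two <;> field_simp

lemma serre_f_last (h : (i : ℕ) + 1 = n) :
    y * x ^ 3 - (qr ^ (-2 : ℤ) + qr⁻¹ * qs⁻¹ + qs ^ (-2 : ℤ)) • (x * y * x ^ 2)
      + ((qr * qs)⁻¹ * (qr ^ (-2 : ℤ) + qr⁻¹ * qs⁻¹ + qs ^ (-2 : ℤ))) • (x ^ 2 * y * x)
      - (qr * qs) ^ (-3 : ℤ) • (x ^ 3 * y)
      = (-(qr * qs) ^ (-3 : ℤ)) •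
        qSerre (cstB n (Fin.last n) i) (cstB n (Fin.last n) (Fin.last n)) 3 x y := by
  have hr := qr_ne_zero
  have hs := qs_ne_zero
  have h' : (Fin.last n : ℕ) = i + 1 := h.symm
  rw [cstB_succ h', cstB_last]
  apply smul_qSerre_three <;> field_simp

end Parameters

section Presentations

lemma mul_eq_smul_mul_iff {K A : Type*} [CommRing K] [Ring A] [Algebra K A] {w v e : A} (c : K)
    (hwv : w * v = 1) (hvw : v * w = 1) : w * e = c • (e * w) ↔ w * e * v = c • e := by
  constructor
  · intro h
    rw [h, smul_mul_assoc, mul_assoc, hwv, mul_one]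
  · intro h
    rw [← smul_mul_assoc, ← h, mul_assoc, hvw, mul_one]

lemma riB_ne_zero {n : ℕ} {ρ : KK} (h : ρ ≠ 0) (i : ℕ) : riB n ρ i ≠ 0 := by
  unfold riB
  split_ifs
  exacts [pow_ne_zero 2 h, h]

variable (n : ℕ)

lemma borelRel_genBE : BorelRel (fun i j => cstB n j i) (SerreB n) (fun i => genBE n (.e i))
    (fun i => genBE n (.w i)) (fun i => genBE n (.winv i)) := by
  have hwv (i : Fin (n + 1)) : genBE n (.w i) * genBE n (.winv i) = 1 := by
    simpa [genBE] using RingQuot.mkAlgHom_rel KK (RelBE.winv_r i)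
  have hvw (i : Fin (n + 1)) : genBE n (.winv i) * genBE n (.w i) = 1 := by
    simpa [genBE] using RingQuot.mkAlgHom_rel KK (RelBE.winv_l i)
  refine ⟨fun i j => ?_, hwv, hvw, fun i j => ?_, ?_⟩
  · simpa [genBE] using RingQuot.mkAlgHom_rel KK (RelBE.comm (.w i) (.w j) trivial trivial)
  · rw [mul_eq_smul_mul_iff _ (hwv i) (hvw i)]
    by_cases hi : (i : ℕ) < n
    · rw [← weight_e hi]
      simpa [genBE] using RingQuot.mkAlgHom_rel KK (RelBE.b2we j i hi)
    · obtain rfl := Fin.eq_last_of_not_lt hi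
      by_cases hj : (j : ℕ) < n
      · rw [← weight_e_last hj]
        simpa [genBE] using RingQuot.mkAlgHom_rel KK (RelBE.b2wne j hj)
      · obtain rfl := Fin.eq_last_of_not_lt hj
        rw [← weight_e_last_last]
        simpa [genBE] using RingQuot.mkAlgHom_rel KK (RelBE.b2wnen (n := n))
  rintro i j m (⟨rfl, h⟩ | ⟨rfl, h | ⟨h, hi⟩⟩ | ⟨rfl, rfl, h⟩)
  · refine (serre_far _ _ h.symm _).trans ?_
    simpa [genBE] using RingQuot.mkAlgHom_rel KK (RelBE.b5e i j h)
  · change qSerre (cstB n j i) _ 2 (genBE n (.e i)) (genBE n (.e j)) = 0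
    rw [serre_e_succ _ _ h]
    simpa [genBE] using RingQuot.mkAlgHom_rel KK (RelBE.b6a i j h (by omega))
  · change qSerre (cstB n j i) _ 2 (genBE n (.e i)) (genBE n (.e j)) = 0
    rw [serre_e_pred _ _ h (by omega)]
    simpa [genBE] using RingQuot.mkAlgHom_rel KK (RelBE.b6b j i h (by omega))
  · change qSerre (cstB n j (Fin.last n)) _ 3 (genBE n (.e _)) (genBE n (.e j)) = 0
    rw [serre_e_last _ _ h]
    simpa [genBE] using RingQuot.mkAlgHom_rel KK (RelBE.b6c j h)

/-- The upper Borel subalgebra of type `B` is presented by the Borel relations. -/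
lemma isBorel_genBE : IsBorel (fun i j => cstB n j i) (SerreB n) (fun i => genBE n (.e i))
    (fun i => genBE n (.w i)) (fun i => genBE n (.winv i)) where
  toBorelRel := borelRel_genBE n
  adjoin_eq_top := by
    rw [eq_top_iff, ← RingQuot.adjoin_range_mkAlgHom]
    apply Algebra.adjoin_mono
    rintro _ ⟨g | g | g, rfl⟩
    exacts [.inl (.inl ⟨g, rfl⟩), .inl (.inr ⟨g, rfl⟩), .inr ⟨g, rfl⟩]
  exists_lift {A} _ _ e' w' v' hr := by
    set gen : GenE (n + 1) → A := fun g => match g with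
      | .e i => e' i
      | .w i => w' i
      | .winv i => v' i
    have hι (g : GenE (n + 1)) : FreeAlgebra.lift KK gen (XE g) = gen g :=
      FreeAlgebra.lift_ι_apply ..
    suffices H : ∀ ⦃x y⦄, RelBE n x y → FreeAlgebra.lift KK gen x = FreeAlgebra.lift KK gen y by
      have hφ (g : GenE (n + 1)) : RingQuot.liftAlgHom KK ⟨FreeAlgebra.lift KK gen, H⟩ (genBE n g)
          = gen g := by
        rw [genBE, RingQuot.liftAlgHom_mkAlgHom_apply, hι]
      exact ⟨_, fun i => hφ (.e i), fun i => hφ (.w i), fun i => hφ (.winv i)⟩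
    intro x y h
    cases h with
    | comm g g' hg hg' =>
      rw [map_mul, map_mul, hι, hι]
      rcases g with i | i | i <;> rcases g' with j | j | j
      exacts [False.elim hg, False.elim hg, False.elim hg,
        False.elim hg', hr.comm i j, (hr.vw_comm j i).symm,
        False.elim hg', hr.vw_comm i j, hr.vv_comm i j]
    | winv_r i => simpa only [map_mul, map_one, hι] using hr.wv i
    | winv_l i => simpa only [map_mul, map_one, hι] using hr.vw i
    | b2we i j hj =>
      simp only [map_mul, map_smul, hι, weight_e hj]
      exact (mul_eq_smul_mul_iff _ (hr.wv j) (hr.vw j)).1 (hr.we j i)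
    | b2wne j hj =>
      simp only [map_mul, map_smul, hι, weight_e_last hj]
      exact (mul_eq_smul_mul_iff _ (hr.wv _) (hr.vw _)).1 (hr.we _ j)
    | b2wnen =>
      simp only [map_mul, map_smul, hι, weight_e_last_last]
      exact (mul_eq_smul_mul_iff _ (hr.wv _) (hr.vw _)).1 (hr.we _ _)
    | b5e i j h =>
      simp only [map_sub, map_mul, map_zero, hι]
      exact (serre_far _ _ h.symm _).symm.trans (hr.serre i j 1 (.inl ⟨rfl, h⟩))
    | b6a i j h hi =>
      simp only [map_add, map_sub, map_mul, map_pow, map_smul, map_zero, hι]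
      exact (serre_e_succ _ _ h).symm.trans (hr.serre i j 2 (.inr (.inl ⟨rfl, .inl h⟩)))
    | b6b i j h hj =>
      simp only [map_add, map_sub, map_mul, map_pow, map_smul, map_zero, hι]
      exact (serre_e_pred _ _ h hj).symm.trans
        (hr.serre j i 2 (.inr (.inl ⟨rfl, .inr ⟨h, by omega⟩⟩)))
    | b6c i h =>
      simp only [map_add, map_sub, map_mul, map_pow, map_smul, map_zero, hι]
      exact (serre_e_last _ _ h).symm.trans (hr.serre _ i 3 (.inr (.inr ⟨rfl, rfl, h⟩)))

lemma borelRel_genBF : BorelRel (cstB n) (SerreB n) (fun i => genBF n (.f i))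
    (fun i => genBF n (.wp i)) (fun i => genBF n (.wpinv i)) := by
  have hwv (i : Fin (n + 1)) : genBF n (.wp i) * genBF n (.wpinv i) = 1 := by
    simpa [genBF] using RingQuot.mkAlgHom_rel KK (RelBF.wpinv_r i)
  have hvw (i : Fin (n + 1)) : genBF n (.wpinv i) * genBF n (.wp i) = 1 := by
    simpa [genBF] using RingQuot.mkAlgHom_rel KK (RelBF.wpinv_l i)
  refine ⟨fun i j => ?_, hwv, hvw, fun i j => ?_, ?_⟩
  · simpa [genBF] using RingQuot.mkAlgHom_rel KK (RelBF.comm (.wp i) (.wp j) trivial trivial)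
  · rw [mul_eq_smul_mul_iff _ (hwv i) (hvw i)]
    by_cases hi : (i : ℕ) < n
    · rw [← weight_f hi]
      simpa [genBF] using RingQuot.mkAlgHom_rel KK (RelBF.b3wpf j i hi)
    · obtain rfl := Fin.eq_last_of_not_lt hi
      by_cases hj : (j : ℕ) < n
      · rw [← weight_f_last hj]
        simpa [genBF] using RingQuot.mkAlgHom_rel KK (RelBF.b3wpnf j hj)
      · obtain rfl := Fin.eq_last_of_not_lt hj
        rw [← weight_f_last_last]
        simpa [genBF] using RingQuot.mkAlgHom_rel KK (RelBF.b3wpnfn (n := n))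
  rintro i j m (⟨rfl, h⟩ | ⟨rfl, h | ⟨h, hi⟩⟩ | ⟨rfl, rfl, h⟩)
  · refine (serre_far _ _ h _).trans ?_
    simpa [genBF] using RingQuot.mkAlgHom_rel KK (RelBF.b5f i j h)
  · refine (smul_eq_zero_iff_right (mul_ne_zero (riB_ne_zero qr_ne_zero i)
      (riB_ne_zero qs_ne_zero i))).1 ((serre_f_succ _ _ h).symm.trans ?_)
    simpa [genBF] using RingQuot.mkAlgHom_rel KK (RelBF.b7a i j h (by omega))
  · refine (smul_eq_zero_iff_right (inv_ne_zero (mul_ne_zero (riB_ne_zero qr_ne_zero (j + 1))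
      (riB_ne_zero qs_ne_zero (j + 1))))).1 ((serre_f_pred _ _ h (by omega)).symm.trans ?_)
    simpa [genBF] using RingQuot.mkAlgHom_rel KK (RelBF.b7b j i h (by omega))
  · refine (smul_eq_zero_iff_right (neg_ne_zero.2 (zpow_ne_zero (-3)
      (mul_ne_zero qr_ne_zero qs_ne_zero)))).1 ((serre_f_last _ _ h).symm.trans ?_)
    simpa [genBF] using RingQuot.mkAlgHom_rel KK (RelBF.b7c j h)

/-- The lower Borel subalgebra of type `B` is presented by the Borel relations. -/
lemma isBorel_genBF : IsBorel (cstB n) (SerreB n) (fun i => genBF n (.f i))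
    (fun i => genBF n (.wp i)) (fun i => genBF n (.wpinv i)) where
  toBorelRel := borelRel_genBF n
  adjoin_eq_top := by
    rw [eq_top_iff, ← RingQuot.adjoin_range_mkAlgHom]
    apply Algebra.adjoin_mono
    rintro _ ⟨g | g | g, rfl⟩
    exacts [.inl (.inl ⟨g, rfl⟩), .inl (.inr ⟨g, rfl⟩), .inr ⟨g, rfl⟩]
  exists_lift {A} _ _ e' w' v' hr := by
    set gen : GenF (n + 1) → A := fun g => match g with
      | .f i => e' i
      | .wp i => w' i
      | .wpinv i => v' i
    have hι (g : GenF (n + 1)) : FreeAlgebra.lift KK gen (XF g) = gen g :=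
      FreeAlgebra.lift_ι_apply ..
    suffices H : ∀ ⦃x y⦄, RelBF n x y → FreeAlgebra.lift KK gen x = FreeAlgebra.lift KK gen y by
      have hφ (g : GenF (n + 1)) : RingQuot.liftAlgHom KK ⟨FreeAlgebra.lift KK gen, H⟩ (genBF n g)
          = gen g := by
        rw [genBF, RingQuot.liftAlgHom_mkAlgHom_apply, hι]
      exact ⟨_, fun i => hφ (.f i), fun i => hφ (.wp i), fun i => hφ (.wpinv i)⟩
    intro x y h
    cases h with
    | comm g g' hg hg' =>
      rw [map_mul, map_mul, hι, hι]
      rcases g with i | i | i <;> rcases g' with j | j | j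
      exacts [False.elim hg, False.elim hg, False.elim hg,
        False.elim hg', hr.comm i j, (hr.vw_comm j i).symm,
        False.elim hg', hr.vw_comm i j, hr.vv_comm i j]
    | wpinv_r i => simpa only [map_mul, map_one, hι] using hr.wv i
    | wpinv_l i => simpa only [map_mul, map_one, hι] using hr.vw i
    | b3wpf i j hj =>
      simp only [map_mul, map_smul, hι, weight_f hj]
      exact (mul_eq_smul_mul_iff _ (hr.wv j) (hr.vw j)).1 (hr.we j i)
    | b3wpnf j hj =>
      simp only [map_mul, map_smul, hι, weight_f_last hj]
      exact (mul_eq_smul_mul_iff _ (hr.wv _) (hr.vw _)).1 (hr.we _ j)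
    | b3wpnfn =>
      simp only [map_mul, map_smul, hι, weight_f_last_last]
      exact (mul_eq_smul_mul_iff _ (hr.wv _) (hr.vw _)).1 (hr.we _ _)
    | b5f i j h =>
      simp only [map_sub, map_mul, map_zero, hι]
      exact (serre_far _ _ h _).symm.trans (hr.serre i j 1 (.inl ⟨rfl, h⟩))
    | b7a i j h hi =>
      simp only [map_add, map_sub, map_mul, map_pow, map_smul, map_zero, hι]
      exact (serre_f_succ _ _ h).trans
        (smul_eq_zero_of_right _ (hr.serre i j 2 (.inr (.inl ⟨rfl, .inl h⟩))))
    | b7b i j h hj =>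
      simp only [map_add, map_sub, map_mul, map_pow, map_smul, map_zero, hι]
      exact (serre_f_pred _ _ h hj).trans
        (smul_eq_zero_of_right _ (hr.serre j i 2 (.inr (.inl ⟨rfl, .inr ⟨h, by omega⟩⟩))))
    | b7c i h =>
      simp only [map_add, map_sub, map_mul, map_pow, map_smul, map_zero, hι]
      exact (serre_f_last _ _ h).trans
        (smul_eq_zero_of_right _ (hr.serre _ i 3 (.inr (.inr ⟨rfl, rfl, h⟩))))

end Presentations

lemma BorelAntipode.map_e_neg {K I B : Type} [Field K] [Ring B] [Algebra K B] {e w v : I → B}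
    {c : I → K} {σ : B →ₗ[K] B} (hσ : BorelAntipode e w v (fun i => -c i) σ) (i : I) :
    σ (e i) = -(c i • (v i * e i)) := by
  rw [hσ.map_e, neg_smul]

lemma map_flip_comm {K H B : Type} [Field K] [Ring H] [Algebra K H] [Ring B] [Algebra K B]
    (p : H →ₗ[K] B →ₗ[K] K) (b b' : B) (t : H ⊗[K] H) :
    LinearMap.mul' K K (TensorProduct.map (p.flip b') (p.flip b) (TensorProduct.comm K H H t))
      = LinearMap.mul' K K (TensorProduct.map (p.flip b) (p.flip b') t) := by
  induction t with
  | zero => simp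
  | tmul x y => simp [mul_comm]
  | add x y hx hy => simp only [map_add, hx, hy]

lemma pairCond_iff {n : ℕ} {ΔB : BA n →ₐ[KK] BA n ⊗[KK] BA n} {εB : BA n →ₐ[KK] KK}
    {Δ' : BA' n →ₐ[KK] BA' n ⊗[KK] BA' n} {ε' : BA' n →ₐ[KK] KK}
    (p : BA' n →ₗ[KK] BA n →ₗ[KK] KK) :
    PairCond n ΔB εB ((Algebra.TensorProduct.comm KK _ _).toAlgHom.comp Δ') ε' p ↔
      IsDualPairing (K := KK) (H := BA' n) (B := BA n) Δ' ε' ΔB εB p ∧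
      PairingValues (fun i j => cstB n j i) (fun i => (riB n qs i - riB n qr i)⁻¹)
        (fun i => genBF n (.f i)) (fun i => genBF n (.wp i)) (fun i => genBF n (.wpinv i))
        (fun i => genBE n (.e i)) (fun i => genBE n (.w i)) (fun i => genBE n (.winv i)) p := by
  have hΔ (x b b') : LinearMap.mul' KK KK (TensorProduct.map (p.flip b') (p.flip b)
      (((Algebra.TensorProduct.comm KK _ _).toAlgHom.comp Δ').toLinearMap x))
      = LinearMap.mul' KK KK (TensorProduct.map (p.flip b) (p.flip b') (Δ' x)) := by
    rw [← map_flip_comm (K := KK) (H := BA' n) (B := BA n) p b b' (Δ' x)]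
    rfl
  unfold PairCond
  constructor
  · rintro ⟨h1, h2, h3, h4, ee, ww, wv, vw, vv, ew, ev, we, ve⟩
    exact ⟨⟨h1, h2, fun x b b' => (h3 x b b').trans (hΔ x b b'), h4⟩,
      ⟨ee, ew, ev, we, ww, wv, ve, vw, vv⟩⟩
  · rintro ⟨h, hv⟩
    exact ⟨h.apply_one, h.one_apply, fun x b b' => (h.apply_mul x b b').trans (hΔ x b b').symm,
      h.mul_apply, hv.ee, hv.ww, hv.wv, hv.vw, hv.vv, hv.ew, hv.ev, hv.we, hv.ve⟩

theorem stmt4 (n : ℕ) :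
    ∃ (ΔB : BA n →ₐ[KK] (BA n ⊗[KK] BA n)) (εB : BA n →ₐ[KK] KK) (SB : BA n →ₗ[KK] BA n)
      (ΔB' : BA' n →ₐ[KK] (BA' n ⊗[KK] BA' n)) (εB' : BA' n →ₐ[KK] KK)
      (SB' : BA' n →ₗ[KK] BA' n),
      -- the Hopf structures of B and B' (restricted from U_{r,s}(so_{2n+1}))
      (∀ i : Fin (n+1),
        ΔB (genBE n (.w i)) = genBE n (.w i) ⊗ₜ[KK] genBE n (.w i) ∧
        ΔB (genBE n (.winv i)) = genBE n (.winv i) ⊗ₜ[KK] genBE n (.winv i) ∧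
        ΔB (genBE n (.e i))
          = genBE n (.e i) ⊗ₜ[KK] 1 + genBE n (.w i) ⊗ₜ[KK] genBE n (.e i)) ∧
      (∀ i : Fin (n+1), εB (genBE n (.w i)) = 1 ∧ εB (genBE n (.winv i)) = 1 ∧
        εB (genBE n (.e i)) = 0) ∧
      SB 1 = 1 ∧ (∀ x y, SB (x * y) = SB y * SB x) ∧
      (∀ i : Fin (n+1), SB (genBE n (.w i)) = genBE n (.winv i) ∧
        SB (genBE n (.winv i)) = genBE n (.w i) ∧
        SB (genBE n (.e i)) = -(genBE n (.winv i) * genBE n (.e i))) ∧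
      (∀ i : Fin (n+1),
        ΔB' (genBF n (.wp i)) = genBF n (.wp i) ⊗ₜ[KK] genBF n (.wp i) ∧
        ΔB' (genBF n (.wpinv i)) = genBF n (.wpinv i) ⊗ₜ[KK] genBF n (.wpinv i) ∧
        ΔB' (genBF n (.f i))
          = 1 ⊗ₜ[KK] genBF n (.f i) + genBF n (.f i) ⊗ₜ[KK] genBF n (.wp i)) ∧
      (∀ i : Fin (n+1), εB' (genBF n (.wp i)) = 1 ∧ εB' (genBF n (.wpinv i)) = 1 ∧
        εB' (genBF n (.f i)) = 0) ∧
      SB' 1 = 1 ∧ (∀ x y, SB' (x * y) = SB' y * SB' x) ∧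
      (∀ i : Fin (n+1), SB' (genBF n (.wp i)) = genBF n (.wpinv i) ∧
        SB' (genBF n (.wpinv i)) = genBF n (.wp i) ∧
        SB' (genBF n (.f i)) = -(genBF n (.f i) * genBF n (.wpinv i))) ∧
      -- there is a unique skew-dual pairing with the prescribed generator values
      (∃! p : BA' n →ₗ[KK] BA n →ₗ[KK] KK, PairCond n ΔB εB ΔB' εB' p) ∧
      -- moreover ⟨S(a), S(b)⟩ = ⟨a, b⟩
      (∀ p : BA' n →ₗ[KK] BA n →ₗ[KK] KK, PairCond n ΔB εB ΔB' εB' p →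
        ∀ a b, p (SB' a) (SB b) = p a b) := by
  have hS := serreCompat_cstB (n := n)
  have hB := isBorel_genBE n
  have hF := isBorel_genBF n
  have ha (i j) : cstB n j i ≠ 0 := cstB_ne_zero j i
  obtain ⟨ΔB, εB, hcB⟩ := hB.exists_coalg hS.swap
  obtain ⟨Δ', ε', hcF⟩ := hF.exists_coalg hS
  obtain ⟨SB, hSB⟩ := hB.exists_antipode hS.swap (fun _ => -1)
  obtain ⟨SF, hSF⟩ := hF.exists_antipode hS (fun i => -cstB n i i)
  refine ⟨ΔB, εB, SB, (Algebra.TensorProduct.comm KK _ _).toAlgHom.comp Δ', ε', SF,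
    fun i => ⟨hcB.comul_w i, hcB.comul_v i, hcB.comul_e i⟩,
    fun i => ⟨hcB.counit_w i, hcB.counit_v i, hcB.counit_e i⟩, hSB.map_one, hSB.map_mul,
    fun i => ⟨hSB.map_w i, hSB.map_v i,
      by simpa only [one_smul] using hSB.map_e_neg (c := fun _ => 1) i⟩,
    fun i => ⟨?_, ?_, ?_⟩, fun i => ⟨hcF.counit_w i, hcF.counit_v i, hcF.counit_e i⟩,
    hSF.map_one, hSF.map_mul, fun i => ⟨hSF.map_w i, hSF.map_v i, ?_⟩, ?_, fun p hp => ?_⟩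
  · exact congrArg (TensorProduct.comm KK _ _) (hcF.comul_w i)
  · exact congrArg (TensorProduct.comm KK _ _) (hcF.comul_v i)
  · refine (congrArg (TensorProduct.comm KK _ _) (hcF.comul_e i)).trans ?_
    rw [map_add, TensorProduct.comm_tmul, TensorProduct.comm_tmul]
  · exact (hSF.map_e_neg i).trans (congrArg Neg.neg (hF.ev i i).symm)
  · obtain ⟨p, hp, hv⟩ := IsBorel.exists_pairing ha hS.swap hS _ hF hB hcF hcB
    exact ⟨p, (pairCond_iff p).2 ⟨hp, hv⟩, fun q hq =>
      ((pairCond_iff q).1 hq).1.ext hcF hF hB ((pairCond_iff q).1 hq).2 hp hv⟩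
  · obtain ⟨hp, hv⟩ := (pairCond_iff p).1 hp
    exact hp.antipode_apply hv ha hF hB hcF hcB (by simp) hSF hSB

end
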